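/- arXiv:2411.17574 — 3 statements merged into one kernel-verified Lean document; each statement's English description precedes it below -/
import Mathlib

section
/- Let Δ ⊂ ℝ¹⁰ be the convex hull of the 18 points e₁, e₂, e₃, e₄, −(e₁+e₂+e₃+e₄), e₅, e₆, e₇, e₈, −(e₅+e₆+e₇+e₈), e₉, −e₉, e₁₀, −e₁₀, e₁+e₅, e₁+e₅+e₉, e₂+e₆, e₂+e₆+e₁₀, where e₁, …, e₁₀ is the standard basis of ℝ¹⁰. Then for every facet F of Δ, the set of the 18 points lying in F has exactly 10 elements and forms a ℤ-basis of the lattice ℤ¹⁰ ⊂ ℝ¹⁰. -/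
noncomputable section

open scoped RealInnerProductSpace

/-- The standard basis vectors of `ℝ¹⁰`. -/
def ee (i : Fin 10) : EuclideanSpace ℝ (Fin 10) := EuclideanSpace.single i 1

/-- The 18 points `e₁, e₂, e₃, e₄, −(e₁+e₂+e₃+e₄), e₅, e₆, e₇, e₈, −(e₅+e₆+e₇+e₈),
e₉, −e₉, e₁₀, −e₁₀, e₁+e₅, e₁+e₅+e₉, e₂+e₆, e₂+e₆+e₁₀` (0-indexed here). -/
def V18 : Set (EuclideanSpace ℝ (Fin 10)) :=
  {ee 0, ee 1, ee 2, ee 3, -(ee 0 + ee 1 + ee 2 + ee 3),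
   ee 4, ee 5, ee 6, ee 7, -(ee 4 + ee 5 + ee 6 + ee 7),
   ee 8, -ee 8, ee 9, -ee 9,
   ee 0 + ee 4, ee 0 + ee 4 + ee 8,
   ee 1 + ee 5, ee 1 + ee 5 + ee 9}

/-- The indicator of a proposition, with values in `ℕ`. -/
def ind (p : Prop) : ℕ := by
  classical exact if p then 1 else 0

lemma ind_true {p : Prop} (h : p) : ind p = 1 := by simp [ind, h]

lemma ind_false {p : Prop} (h : ¬ p) : ind p = 0 := by simp [ind, h]

set_option maxHeartbeats 2000000 in
/-- The part of the face complex around `x, y, x+y, x+y+z, z, -z`. -/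
lemma group_count {E : Type*} [AddCommGroup E] (M : Submodule ℤ E) (x y z : E)
    (p1 p5 pa pb pp pm : Prop)
    (h15 : ¬ (p1 ∧ p5)) (hpm : ¬ (pp ∧ pm)) (hap : ¬ (pa ∧ pp)) (hbm : ¬ (pb ∧ pm))
    (m1 : p1 → x ∈ M) (m5 : p5 → y ∈ M) (ma : pa → x + y ∈ M) (mb : pb → x + y + z ∈ M)
    (mp : pp → z ∈ M) (mm : pm → -z ∈ M) :
    ind p1 + ind p5 + ind pa + ind pb + ind pp + ind pm + ind (¬ (p1 ∨ pa ∨ pb))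
      + ind (¬ (p5 ∨ pa ∨ pb)) ≤ 3 ∧
    (ind p1 + ind p5 + ind pa + ind pb + ind pp + ind pm + ind (¬ (p1 ∨ pa ∨ pb))
      + ind (¬ (p5 ∨ pa ∨ pb)) = 3 →
      z ∈ M ∧ ((p1 ∨ pa ∨ pb) → x ∈ M) ∧ ((p5 ∨ pa ∨ pb) → y ∈ M)) := by
  have hz : -z ∈ M → z ∈ M := fun h => by simpa using M.neg_mem h
  have hab : x + y ∈ M → x + y + z ∈ M → z ∈ M := fun h h' => by
    simpa using M.sub_mem h' h
  have hbz : x + y + z ∈ M → z ∈ M → x + y ∈ M := fun h h' => by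
    simpa using M.sub_mem h h'
  have hx : x + y ∈ M → x ∈ M → y ∈ M := fun h h' => by
    simpa using M.sub_mem h h'
  have hy : x + y ∈ M → y ∈ M → x ∈ M := fun h h' => by
    simpa using M.sub_mem h h'
  by_cases k1 : p1 <;> by_cases k5 : p5 <;> by_cases ka : pa <;> by_cases kb : pb <;>
    by_cases kp : pp <;> by_cases km : pm <;>
    simp only [k1, k5, ka, kb, kp, km, and_self, not_true_eq_false] at h15 hpm hap hbm <;>
    simp only [k1, k5, ka, kb, kp, km, ind, true_or, or_true, or_self, not_true_eq_false,
      not_false_eq_true, if_true, if_false, forall_true_left, false_imp_iff] at * <;>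
    refine ⟨by norm_num, ?_⟩ <;> first | (intro hs; exfalso; omega) | tauto

/-- The part of the face complex around `u, v, -(x+y+u+v)`. -/
lemma fiber_count {E : Type*} [AddCommGroup E] (M : Submodule ℤ E) (x y u v : E)
    (px py pu pv ps : Prop) (h : ¬ (px ∧ py ∧ pu ∧ pv ∧ ps))
    (mu : pu → u ∈ M) (mv : pv → v ∈ M) (ms : ps → -(x + y + u + v) ∈ M) :
    ind pu + ind pv + ind ps ≤ 2 + ind (¬ px) + ind (¬ py) ∧
    (ind pu + ind pv + ind ps = 2 + ind (¬ px) + ind (¬ py) →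
      (px → x ∈ M) → (py → y ∈ M) → x ∈ M ∧ y ∈ M ∧ u ∈ M ∧ v ∈ M) := by
  have h1 : -(x + y + u + v) ∈ M → y ∈ M → u ∈ M → v ∈ M → x ∈ M := fun a b c d => by
    have := M.neg_mem (M.add_mem (M.add_mem (M.add_mem a b) c) d)
    convert this using 1; abel
  have h2 : -(x + y + u + v) ∈ M → x ∈ M → u ∈ M → v ∈ M → y ∈ M := fun a b c d => by
    have := M.neg_mem (M.add_mem (M.add_mem (M.add_mem a b) c) d)
    convert this using 1; abel
  have h3 : -(x + y + u + v) ∈ M → x ∈ M → y ∈ M → v ∈ M → u ∈ M := fun a b c d => by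
    have := M.neg_mem (M.add_mem (M.add_mem (M.add_mem a b) c) d)
    convert this using 1; abel
  have h4 : -(x + y + u + v) ∈ M → x ∈ M → y ∈ M → u ∈ M → v ∈ M := fun a b c d => by
    have := M.neg_mem (M.add_mem (M.add_mem (M.add_mem a b) c) d)
    convert this using 1; abel
  by_cases k1 : px <;> by_cases k5 : py <;> by_cases ka : pu <;> by_cases kb : pv <;>
    by_cases kp : ps <;>
    simp only [k1, k5, ka, kb, kp, and_self, not_true_eq_false] at h <;>
    simp only [k1, k5, ka, kb, kp, ind, not_true_eq_false,
      not_false_eq_true, if_true, if_false, forall_true_left, false_imp_iff] at * <;>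
    refine ⟨by norm_num, ?_⟩ <;> first | (intro hs; exfalso; omega) | tauto

/-- The 18 points as a family. -/
def pt : Fin 18 → EuclideanSpace ℝ (Fin 10) :=
  ![ee 0, ee 1, ee 2, ee 3, -(ee 0 + ee 1 + ee 2 + ee 3),
   ee 4, ee 5, ee 6, ee 7, -(ee 4 + ee 5 + ee 6 + ee 7),
   ee 8, -ee 8, ee 9, -ee 9,
   ee 0 + ee 4, ee 0 + ee 4 + ee 8,
   ee 1 + ee 5, ee 1 + ee 5 + ee 9]

lemma range_pt : Set.range pt = V18 := by
  simp only [pt, Matrix.range_cons, Matrix.range_empty, V18, Set.union_empty,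
    Set.singleton_union]

/-- The points are distinguished by an explicit linear form. -/
lemma pt_injective : Function.Injective pt := by
  let g : EuclideanSpace ℝ (Fin 10) → ℝ := fun x =>
    x 0 + 2 * x 1 + 4 * x 2 + 8 * x 3 + 16 * x 4 + 32 * x 5 + 64 * x 6 + 128 * x 7
      + 256 * x 8 + 512 * x 9
  let k : Fin 18 → ℤ := ![1, 2, 4, 8, -15, 16, 32, 64, 128, -240, 256, -256, 512, -512,
    17, 273, 34, 546]
  have hk : ∀ i, g (pt i) = k i := by
    intro i
    fin_cases i <;> simp [g, k, pt, ee] <;> norm_num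
  have hinj : Function.Injective k := by decide
  intro i j hij
  apply hinj
  have : (k i : ℝ) = k j := by rw [← hk, ← hk, hij]
  exact_mod_cast this

lemma ncard_tight (S : Set (EuclideanSpace ℝ (Fin 10))) :
    (V18 ∩ S).ncard = ∑ i, ind (pt i ∈ S) := by
  classical
  have : V18 ∩ S = pt '' ((Finset.univ.filter (fun i => pt i ∈ S) : Finset (Fin 18)) : Set (Fin 18)) := by
    rw [← range_pt]
    ext x
    constructor
    · rintro ⟨⟨i, rfl⟩, h⟩
      exact ⟨i, by simpa using h, rfl⟩
    · rintro ⟨i, h, rfl⟩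
      exact ⟨⟨i, rfl⟩, by simpa using h⟩
  rw [this, Set.ncard_image_of_injective _ pt_injective, Set.ncard_coe_finset,
    Finset.card_filter]
  simp only [ind]

lemma span_ee : Submodule.span ℝ (Set.range ee) = ⊤ := by
  have : ee = (EuclideanSpace.basisFun (Fin 10) ℝ).toBasis := by
    ext i : 1
    simp [ee]
  rw [this]
  exact (EuclideanSpace.basisFun (Fin 10) ℝ).toBasis.span_eq

/-- A submodule over a subring of scalars containing all `ee i` for the tight points. -/
lemma tight_span (l : EuclideanSpace ℝ (Fin 10) →ₗ[ℝ] ℝ) (m : ℝ) (hm : 0 < m)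
    (hl : ∀ i, l (pt i) ≤ m) (M : Submodule ℤ (EuclideanSpace ℝ (Fin 10)))
    (T : Fin 18 → Prop) (hT : ∀ i, T i → l (pt i) = m) (hM : ∀ i, T i → pt i ∈ M) :
    ∑ i, ind (T i) ≤ 10 ∧ (∑ i, ind (T i) = 10 → ∀ i, ee i ∈ M) := by
  have l0 := hl 0
  have l1 := hl 1
  have l2 := hl 2
  have l3 := hl 3
  have l4 := hl 4
  have l5 := hl 5
  have l6 := hl 6
  have l7 := hl 7
  have l8 := hl 8
  have l9 := hl 9
  have l10 := hl 10
  have l11 := hl 11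
  have l12 := hl 12
  have l13 := hl 13
  have l14 := hl 14
  have l15 := hl 15
  have l16 := hl 16
  have l17 := hl 17
  have t0 := hT 0
  have t1 := hT 1
  have t2 := hT 2
  have t3 := hT 3
  have t4 := hT 4
  have t5 := hT 5
  have t6 := hT 6
  have t7 := hT 7
  have t8 := hT 8
  have t9 := hT 9
  have t10 := hT 10
  have t11 := hT 11
  have t12 := hT 12
  have t13 := hT 13
  have t14 := hT 14
  have t15 := hT 15
  have t16 := hT 16
  have t17 := hT 17
  simp only [pt, Matrix.cons_val, map_add, map_neg] at l0 l1 l2 l3 l4 l5 l6 l7 l8 l9 l10 l11 l12 l13 l14 l15 l16 l17 t0 t1 t2 t3 t4 t5 t6 t7 t8 t9 t10 t11 t12 t13 t14 t15 t16 t17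
  have G1 := group_count M (ee 0) (ee 4) (ee 8) (T 0) (T 5) (T 14) (T 15) (T 10) (T 11)
    (fun ⟨a, b⟩ => by linarith [t0 a, t5 b]) (fun ⟨a, b⟩ => by linarith [t10 a, t11 b])
    (fun ⟨a, b⟩ => by linarith [t14 a, t10 b]) (fun ⟨a, b⟩ => by linarith [t15 a, t11 b])
    (hM 0) (hM 5) (hM 14) (hM 15) (hM 10) (hM 11)
  have G2 := group_count M (ee 1) (ee 5) (ee 9) (T 1) (T 6) (T 16) (T 17) (T 12) (T 13)
    (fun ⟨a, b⟩ => by linarith [t1 a, t6 b]) (fun ⟨a, b⟩ => by linarith [t12 a, t13 b])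
    (fun ⟨a, b⟩ => by linarith [t16 a, t12 b]) (fun ⟨a, b⟩ => by linarith [t17 a, t13 b])
    (hM 1) (hM 6) (hM 16) (hM 17) (hM 12) (hM 13)
  have b0 : (T 0 ∨ T 14 ∨ T 15) → -m ≤ l (ee 0) := by
    rintro (h | h | h)
    · linarith [t0 h]
    · linarith [t14 h]
    · linarith [t15 h]
  have b4 : (T 5 ∨ T 14 ∨ T 15) → -m ≤ l (ee 4) := by
    rintro (h | h | h)
    · linarith [t5 h]
    · linarith [t14 h]
    · linarith [t15 h]
  have b1 : (T 1 ∨ T 16 ∨ T 17) → -m ≤ l (ee 1) := by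
    rintro (h | h | h)
    · linarith [t1 h]
    · linarith [t16 h]
    · linarith [t17 h]
  have b5 : (T 6 ∨ T 16 ∨ T 17) → -m ≤ l (ee 5) := by
    rintro (h | h | h)
    · linarith [t6 h]
    · linarith [t16 h]
    · linarith [t17 h]
  have X := fiber_count M (ee 0) (ee 1) (ee 2) (ee 3) (T 0 ∨ T 14 ∨ T 15) (T 1 ∨ T 16 ∨ T 17)
    (T 2) (T 3) (T 4)
    (fun ⟨a, b, c, d, e⟩ => by linarith [b0 a, b1 b, t2 c, t3 d, t4 e])
    (hM 2) (hM 3) (hM 4)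
  have Y := fiber_count M (ee 4) (ee 5) (ee 6) (ee 7) (T 5 ∨ T 14 ∨ T 15) (T 6 ∨ T 16 ∨ T 17)
    (T 7) (T 8) (T 9)
    (fun ⟨a, b, c, d, e⟩ => by linarith [b4 a, b5 b, t7 c, t8 d, t9 e])
    (hM 7) (hM 8) (hM 9)
  obtain ⟨G1, G1'⟩ := G1
  obtain ⟨G2, G2'⟩ := G2
  obtain ⟨X, X'⟩ := X
  obtain ⟨Y, Y'⟩ := Y
  have hsum : ∑ i, ind (T i) = ind (T 0) + ind (T 1) + ind (T 2) + ind (T 3) + ind (T 4)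
      + ind (T 5) + ind (T 6) + ind (T 7) + ind (T 8) + ind (T 9) + ind (T 10) + ind (T 11)
      + ind (T 12) + ind (T 13) + ind (T 14) + ind (T 15) + ind (T 16) + ind (T 17) := by
    simp only [Fin.sum_univ_succ, Fin.sum_univ_zero, add_zero, ← add_assoc]
    rfl
  rw [hsum]
  refine ⟨by omega, fun h => ?_⟩
  obtain ⟨h8, hx0, hy0⟩ := G1' (by omega)
  obtain ⟨h9, hx1, hy1⟩ := G2' (by omega)
  obtain ⟨h0, h1, h2, h3⟩ := X' (by omega) hx0 hx1
  obtain ⟨h4, h5, h6, h7⟩ := Y' (by omega) hy0 hy1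
  intro i
  fin_cases i <;> assumption

lemma pt_mem_int (i : Fin 18) : pt i ∈ Submodule.span ℤ (Set.range ee) := by
  have h : ∀ j, ee j ∈ Submodule.span ℤ (Set.range ee) :=
    fun j => Submodule.subset_span ⟨j, rfl⟩
  fin_cases i <;> simp only [pt] <;>
    first
    | exact h _
    | exact Submodule.neg_mem _ (h _)
    | exact Submodule.add_mem _ (h _) (h _)
    | exact Submodule.add_mem _ (Submodule.add_mem _ (h _) (h _)) (h _)
    | exact Submodule.neg_mem _ (Submodule.add_mem _ (Submodule.add_mem _
        (Submodule.add_mem _ (h _) (h _)) (h _)) (h _))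

lemma finite_V18 : V18.Finite := range_pt ▸ Set.finite_range pt

/-- An exposed face is the convex hull of the points it contains. -/
lemma face_eq (F : Set (EuclideanSpace ℝ (Fin 10)))
    (hface : IsExposed ℝ (convexHull ℝ V18) F) : F = convexHull ℝ (V18 ∩ F) := by
  have hc : IsCompact (convexHull ℝ V18) := finite_V18.isCompact_convexHull ℝ
  have hFc : IsCompact F := hface.isCompact hc
  have hFv : Convex ℝ F := hface.convex (convex_convexHull ℝ _)
  apply subset_antisymm
  · have hext : F.extremePoints ℝ ⊆ V18 ∩ F := fun x hx =>
      ⟨extremePoints_convexHull_subset (hface.isExtreme.extremePoints_subset_extremePoints hx),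
        hx.1⟩
    have hfin : (V18 ∩ F).Finite := finite_V18.inter_of_left F
    calc F = closure (convexHull ℝ (F.extremePoints ℝ)) :=
          (closure_convexHull_extremePoints hFc hFv).symm
      _ ⊆ closure (convexHull ℝ (V18 ∩ F)) := closure_mono (convexHull_mono hext)
      _ = convexHull ℝ (V18 ∩ F) := (hfin.isClosed_convexHull ℝ).closure_eq
  · exact convexHull_min Set.inter_subset_right hFv

/-- The whole configuration affinely spans. -/
lemma vectorSpan_V18 : vectorSpan ℝ V18 = ⊤ := by
  rw [eq_top_iff, ← span_ee, Submodule.span_le]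
  have hd : ∀ i j, pt i - pt j ∈ vectorSpan ℝ V18 := fun i j =>
    vsub_mem_vectorSpan ℝ (range_pt ▸ ⟨i, rfl⟩) (range_pt ▸ ⟨j, rfl⟩)
  have h0 : ee 0 ∈ vectorSpan ℝ V18 := by simpa [pt] using hd 14 5
  have h4 : ee 4 ∈ vectorSpan ℝ V18 := by simpa [pt] using hd 14 0
  have h1 : ee 1 ∈ vectorSpan ℝ V18 := by simpa [pt] using hd 16 6
  have h5 : ee 5 ∈ vectorSpan ℝ V18 := by simpa [pt] using hd 16 1
  have h8 : ee 8 ∈ vectorSpan ℝ V18 := by simpa [pt] using hd 15 14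
  have h9 : ee 9 ∈ vectorSpan ℝ V18 := by simpa [pt] using hd 17 16
  have h2 : ee 2 ∈ vectorSpan ℝ V18 := by simpa [pt] using add_mem (hd 2 0) h0
  have h3 : ee 3 ∈ vectorSpan ℝ V18 := by simpa [pt] using add_mem (hd 3 0) h0
  have h6 : ee 6 ∈ vectorSpan ℝ V18 := by simpa [pt] using add_mem (hd 7 0) h0
  have h7 : ee 7 ∈ vectorSpan ℝ V18 := by simpa [pt] using add_mem (hd 8 0) h0
  rintro _ ⟨i, rfl⟩
  fin_cases i <;> assumption

/-- Let `Δ = conv(V18)`.  For every facet `F` of `Δ` (an exposed face of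
dimension `9`), the set of the 18 points lying in `F` has exactly 10 elements, is linearly
independent over `ℤ`, and spans the integer lattice `ℤ¹⁰` over `ℤ`; i.e. it forms a
`ℤ`-basis of `ℤ¹⁰ ⊂ ℝ¹⁰`. -/
theorem stmt5 (F : Set (EuclideanSpace ℝ (Fin 10)))
    (hface : IsExposed ℝ (convexHull ℝ V18) F)
    (hdim : Module.finrank ℝ (vectorSpan ℝ F) = 9) :
    (V18 ∩ F).ncard = 10 ∧
    LinearIndependent ℤ (fun p : ↥(V18 ∩ F) => (p : EuclideanSpace ℝ (Fin 10))) ∧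
    Submodule.span ℤ (V18 ∩ F) = Submodule.span ℤ (Set.range ee) := by
  classical
  have hne : F.Nonempty := by
    rw [Set.nonempty_iff_ne_empty]
    rintro rfl
    rw [vectorSpan_empty, finrank_bot] at hdim
    omega
  have hF := face_eq F hface
  have hfin : (V18 ∩ F).Finite := finite_V18.inter_of_left F
  have : Fintype ↥(V18 ∩ F) := hfin.fintype
  have hvs : vectorSpan ℝ F = vectorSpan ℝ (V18 ∩ F) := by
    conv_lhs => rw [hF]
    rw [← direction_affineSpan, affineSpan_convexHull, direction_affineSpan]
  have hcard : (V18 ∩ F).ncard = Fintype.card ↥(V18 ∩ F) := by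
    rw [← Nat.card_coe_set_eq, Nat.card_eq_fintype_card]
  have hneS : (V18 ∩ F).Nonempty := by
    rw [← convexHull_nonempty_iff (𝕜 := ℝ), ← hF]; exact hne
  have hge : 10 ≤ (V18 ∩ F).ncard := by
    have : Nonempty ↥(V18 ∩ F) := hneS.to_subtype
    have := finrank_vectorSpan_range_add_one_le ℝ
      (fun p : ↥(V18 ∩ F) => (p : EuclideanSpace ℝ (Fin 10)))
    rw [Subtype.range_coe, ← hvs, hdim] at this
    omega
  obtain ⟨l, hl⟩ := hface hne
  obtain ⟨x, hx⟩ := hne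
  have hx' := hx
  rw [hl] at hx'
  obtain ⟨hxm, hxl⟩ := hx'
  have hle : ∀ i, l (pt i) ≤ l x := fun i =>
    hxl _ (subset_convexHull ℝ _ (range_pt ▸ ⟨i, rfl⟩))
  have hmem : ∀ i, pt i ∈ F ↔ l (pt i) = l x := by
    intro i
    constructor
    · intro h
      rw [hl] at h
      exact le_antisymm (hle i) (h.2 x hxm)
    · intro h
      rw [hl]
      exact ⟨subset_convexHull ℝ _ (range_pt ▸ ⟨i, rfl⟩), fun y hy => h ▸ hxl y hy⟩
  have hpos : 0 < l x := by
    by_contra hneg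
    have hall : ∀ i, pt i ∈ F := by
      intro i
      rw [hmem]
      have l0 := hle 0
      have l1 := hle 1
      have l2 := hle 2
      have l3 := hle 3
      have l4 := hle 4
      have l5 := hle 5
      have l6 := hle 6
      have l7 := hle 7
      have l8 := hle 8
      have l9 := hle 9
      have l10 := hle 10
      have l11 := hle 11
      have l12 := hle 12
      have l13 := hle 13
      simp only [pt, Matrix.cons_val, map_add, map_neg] at l0 l1 l2 l3 l4 l5 l6 l7 l8 l9 l10 l11 l12 l13
      fin_cases i <;> simp only [pt, Matrix.cons_val, Fin.reduceFinMk, Fin.zero_eta, Fin.mk_one, map_add, map_neg] <;> linarith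
    have hsub : V18 ∩ F = V18 := by
      rw [Set.inter_eq_left, ← range_pt]
      rintro _ ⟨i, rfl⟩
      exact hall i
    rw [hvs, hsub, vectorSpan_V18, finrank_top, finrank_euclideanSpace_fin] at hdim
    omega
  have key := tight_span l.toLinearMap (l x) hpos hle (Submodule.span ℤ (V18 ∩ F))
    (fun i => pt i ∈ F) (fun i h => (hmem i).1 h)
    (fun i h => Submodule.subset_span ⟨range_pt ▸ ⟨i, rfl⟩, h⟩)
  rw [← ncard_tight] at key
  have h10 : (V18 ∩ F).ncard = 10 := le_antisymm key.1 hge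
  have hee := key.2 h10
  have hspan : Submodule.span ℤ (V18 ∩ F) = Submodule.span ℤ (Set.range ee) := by
    apply le_antisymm
    · rw [Submodule.span_le]
      rintro v ⟨hv, -⟩
      rw [← range_pt] at hv
      obtain ⟨i, rfl⟩ := hv
      exact pt_mem_int i
    · rw [Submodule.span_le]
      rintro _ ⟨i, rfl⟩
      exact hee i
  refine ⟨h10, ?_, hspan⟩
  have hR : LinearIndependent ℝ (fun p : ↥(V18 ∩ F) => (p : EuclideanSpace ℝ (Fin 10))) := by
    apply linearIndependent_of_top_le_span_of_card_eq_finrank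
    · rw [Subtype.range_coe, ← span_ee, Submodule.span_le]
      rintro _ ⟨i, rfl⟩
      exact Submodule.span_subset_span ℤ ℝ _ (hee i)
    · rw [← hcard, h10, finrank_euclideanSpace_fin]
  exact hR.restrict_scalars' ℤ
end
end

section
/- Fix an integer r ≥ 1 and let e₁, …, e₅ᵣ be the standard basis of ℝ^{5r}. Define the 8r+2 points: uᵢ = eᵢ for 1 ≤ i ≤ 2r, u_{2r+1} = −(e₁+⋯+e_{2r}); vᵢ = e_{2r+i} for 1 ≤ i ≤ 2r, v_{2r+1} = −(e_{2r+1}+⋯+e_{4r}); w_{i,1} = e_{4r+i} and w_{i,2} = −e_{4r+i} for 1 ≤ i ≤ r; yᵢ = uᵢ + vᵢ for 1 ≤ i ≤ r; zᵢ = w_{i,1} + yᵢ for 1 ≤ i ≤ r. Let Δ_r be the convex hull of these 8r+2 points. Then the origin 0 lies in the interior of Δ_r and the set of extreme points of Δ_r is exactly this set of 8r+2 points. -/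
noncomputable section

/-- `u i = e i` for `1 ≤ i ≤ 2r` (0-indexed: `i : Fin (2r)`). -/
def uvec (r : ℕ) (i : Fin (2 * r)) : EuclideanSpace ℝ (Fin (5 * r)) :=
  EuclideanSpace.single (Fin.castLE (by omega) i) 1

/-- `v i = e (2r + i)` for `1 ≤ i ≤ 2r`. -/
def vvec (r : ℕ) (i : Fin (2 * r)) : EuclideanSpace ℝ (Fin (5 * r)) :=
  EuclideanSpace.single ⟨2 * r + (i : ℕ), by have := i.isLt; omega⟩ 1

/-- `u_{2r+1} = −(e₁ + ⋯ + e_{2r})`. -/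
def uLast (r : ℕ) : EuclideanSpace ℝ (Fin (5 * r)) := -(∑ i : Fin (2 * r), uvec r i)

/-- `v_{2r+1} = −(e_{2r+1} + ⋯ + e_{4r})`. -/
def vLast (r : ℕ) : EuclideanSpace ℝ (Fin (5 * r)) := -(∑ i : Fin (2 * r), vvec r i)

/-- `w_{i,1} = e_{4r+i}` for `1 ≤ i ≤ r`; `w_{i,2}` is its negative. -/
def wvec (r : ℕ) (i : Fin r) : EuclideanSpace ℝ (Fin (5 * r)) :=
  EuclideanSpace.single ⟨4 * r + (i : ℕ), by have := i.isLt; omega⟩ 1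

/-- `y i = u i + v i` for `1 ≤ i ≤ r`. -/
def yvec (r : ℕ) (i : Fin r) : EuclideanSpace ℝ (Fin (5 * r)) :=
  uvec r (Fin.castLE (by omega) i) + vvec r (Fin.castLE (by omega) i)

/-- `z i = w_{i,1} + y i` for `1 ≤ i ≤ r`. -/
def zvec (r : ℕ) (i : Fin r) : EuclideanSpace ℝ (Fin (5 * r)) :=
  wvec r i + yvec r i

/-- The set of `8r + 2` points `u₁, …, u_{2r+1}, v₁, …, v_{2r+1}, w_{1,1}, w_{1,2}, …,
w_{r,1}, w_{r,2}, y₁, …, y_r, z₁, …, z_r`. -/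
def Vr (r : ℕ) : Set (EuclideanSpace ℝ (Fin (5 * r))) :=
  Set.range (uvec r) ∪ {uLast r} ∪ Set.range (vvec r) ∪ {vLast r} ∪
  Set.range (wvec r) ∪ Set.range (fun i : Fin r => -(wvec r i)) ∪
  Set.range (yvec r) ∪ Set.range (zvec r)

/-- Index type of the points. -/
abbrev PIdx (r : ℕ) : Type :=
  Fin (2 * r) ⊕ Unit ⊕ Fin (2 * r) ⊕ Unit ⊕ Fin r ⊕ Fin r ⊕ Fin r ⊕ Fin r

/-- The family of points. -/
def ptOf (r : ℕ) : PIdx r → EuclideanSpace ℝ (Fin (5 * r))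
  | .inl i => uvec r i
  | .inr (.inl _) => uLast r
  | .inr (.inr (.inl i)) => vvec r i
  | .inr (.inr (.inr (.inl _))) => vLast r
  | .inr (.inr (.inr (.inr (.inl i)))) => wvec r i
  | .inr (.inr (.inr (.inr (.inr (.inl i))))) => -wvec r i
  | .inr (.inr (.inr (.inr (.inr (.inr (.inl i)))))) => yvec r i
  | .inr (.inr (.inr (.inr (.inr (.inr (.inr i)))))) => zvec r i

theorem range_ptOf (r : ℕ) : Set.range (ptOf r) = Vr r := by
  ext x
  simp [Vr, ptOf, eq_comm, or_assoc]
  tauto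

theorem uvec_app (r : ℕ) (i : Fin (2 * r)) (k : Fin (5 * r)) :
    uvec r i k = if (k : ℕ) = i then 1 else 0 := by
  simp [uvec, Fin.ext_iff]

theorem vvec_app (r : ℕ) (i : Fin (2 * r)) (k : Fin (5 * r)) :
    vvec r i k = if (k : ℕ) = 2 * r + i then 1 else 0 := by
  simp [vvec, Fin.ext_iff]

theorem wvec_app (r : ℕ) (i : Fin r) (k : Fin (5 * r)) :
    wvec r i k = if (k : ℕ) = 4 * r + i then 1 else 0 := by
  simp [wvec, Fin.ext_iff]

theorem uLast_app (r : ℕ) (k : Fin (5 * r)) :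
    uLast r k = if (k : ℕ) < 2 * r then -1 else 0 := by
  simp only [uLast, PiLp.neg_apply, WithLp.ofLp_sum, Finset.sum_apply, uvec_app]
  split_ifs with h
  · rw [Finset.sum_eq_single (⟨k, h⟩ : Fin (2 * r))]
    · simp
    · intro b _ hb
      rw [if_neg]
      intro h2
      exact hb (Fin.ext h2.symm)
    · simp
  · rw [Finset.sum_eq_zero, neg_zero]
    intro b _
    rw [if_neg]
    omega

theorem vLast_app (r : ℕ) (k : Fin (5 * r)) :
    vLast r k = if 2 * r ≤ (k : ℕ) ∧ (k : ℕ) < 4 * r then -1 else 0 := by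
  simp only [vLast, PiLp.neg_apply, WithLp.ofLp_sum, Finset.sum_apply, vvec_app]
  split_ifs with h
  · rw [Finset.sum_eq_single (⟨k - 2 * r, by omega⟩ : Fin (2 * r))]
    · rw [if_pos]
      simp only
      omega
    · intro b _ hb
      rw [if_neg]
      intro h2
      apply hb
      ext
      simp only
      omega
    · simp
  · rw [Finset.sum_eq_zero, neg_zero]
    intro b _
    rw [if_neg]
    omega

theorem yvec_app (r : ℕ) (i : Fin r) (k : Fin (5 * r)) :
    yvec r i k = (if (k : ℕ) = i then 1 else 0) + if (k : ℕ) = 2 * r + i then 1 else 0 := by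
  simp [yvec, uvec_app, vvec_app]

theorem zvec_app (r : ℕ) (i : Fin r) (k : Fin (5 * r)) :
    zvec r i k = (if (k : ℕ) = 4 * r + i then 1 else 0) +
      ((if (k : ℕ) = i then 1 else 0) + if (k : ℕ) = 2 * r + i then 1 else 0) := by
  simp [zvec, yvec_app, wvec_app]

/-- The `k`-th coordinate as a linear functional. -/
def cf (r : ℕ) (k : ℕ) (h : k < 5 * r) : EuclideanSpace ℝ (Fin (5 * r)) →ₗ[ℝ] ℝ :=
  (EuclideanSpace.proj (⟨k, h⟩ : Fin (5 * r)) : EuclideanSpace ℝ (Fin (5 * r)) →L[ℝ] ℝ).toLinearMap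

theorem cf_app (r k : ℕ) (h : k < 5 * r) (x : EuclideanSpace ℝ (Fin (5 * r))) :
    cf r k h x = x ⟨k, h⟩ := rfl

/-- Coordinates of the first block. -/
def cu (r k : ℕ) (h : k < 2 * r) : EuclideanSpace ℝ (Fin (5 * r)) →ₗ[ℝ] ℝ :=
  cf r k (by omega)

/-- Coordinates of the second block. -/
def cv (r k : ℕ) (h : k < 2 * r) : EuclideanSpace ℝ (Fin (5 * r)) →ₗ[ℝ] ℝ :=
  cf r (2 * r + k) (by omega)

/-- Coordinates of the third block. -/
def cw (r k : ℕ) (h : k < r) : EuclideanSpace ℝ (Fin (5 * r)) →ₗ[ℝ] ℝ :=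
  cf r (4 * r + k) (by omega)

theorem cu_uvec (r k : ℕ) (h : k < 2 * r) (i : Fin (2 * r)) :
    cu r k h (uvec r i) = if k = (i : ℕ) then 1 else 0 := by
  simp only [cu, cf_app, uvec_app]

theorem cu_uLast (r k : ℕ) (h : k < 2 * r) :
    cu r k h (uLast r) = -1 := by
  simp only [cu, cf_app, uLast_app]
  split_ifs <;> first | omega | norm_num

theorem cu_vvec (r k : ℕ) (h : k < 2 * r) (i : Fin (2 * r)) :
    cu r k h (vvec r i) = 0 := by
  simp only [cu, cf_app, vvec_app]
  split_ifs <;> first | omega | norm_num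

theorem cu_vLast (r k : ℕ) (h : k < 2 * r) :
    cu r k h (vLast r) = 0 := by
  simp only [cu, cf_app, vLast_app]
  split_ifs <;> first | omega | norm_num

theorem cu_wvec (r k : ℕ) (h : k < 2 * r) (i : Fin (r)) :
    cu r k h (wvec r i) = 0 := by
  simp only [cu, cf_app, wvec_app]
  split_ifs <;> first | omega | norm_num

theorem cu_yvec (r k : ℕ) (h : k < 2 * r) (i : Fin (r)) :
    cu r k h (yvec r i) = if k = (i : ℕ) then 1 else 0 := by
  simp only [cu, cf_app, yvec_app]
  split_ifs <;> first | omega | norm_num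

theorem cu_zvec (r k : ℕ) (h : k < 2 * r) (i : Fin (r)) :
    cu r k h (zvec r i) = if k = (i : ℕ) then 1 else 0 := by
  simp only [cu, cf_app, zvec_app]
  split_ifs <;> first | omega | norm_num

theorem cv_uvec (r k : ℕ) (h : k < 2 * r) (i : Fin (2 * r)) :
    cv r k h (uvec r i) = 0 := by
  simp only [cv, cf_app, uvec_app]
  split_ifs <;> first | omega | norm_num

theorem cv_uLast (r k : ℕ) (h : k < 2 * r) :
    cv r k h (uLast r) = 0 := by
  simp only [cv, cf_app, uLast_app]
  split_ifs <;> first | omega | norm_num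

theorem cv_vvec (r k : ℕ) (h : k < 2 * r) (i : Fin (2 * r)) :
    cv r k h (vvec r i) = if k = (i : ℕ) then 1 else 0 := by
  simp only [cv, cf_app, vvec_app]
  split_ifs <;> first | omega | norm_num

theorem cv_vLast (r k : ℕ) (h : k < 2 * r) :
    cv r k h (vLast r) = -1 := by
  simp only [cv, cf_app, vLast_app]
  split_ifs <;> first | omega | norm_num

theorem cv_wvec (r k : ℕ) (h : k < 2 * r) (i : Fin (r)) :
    cv r k h (wvec r i) = 0 := by
  simp only [cv, cf_app, wvec_app]
  split_ifs <;> first | omega | norm_num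

theorem cv_yvec (r k : ℕ) (h : k < 2 * r) (i : Fin (r)) :
    cv r k h (yvec r i) = if k = (i : ℕ) then 1 else 0 := by
  simp only [cv, cf_app, yvec_app]
  split_ifs <;> first | omega | norm_num

theorem cv_zvec (r k : ℕ) (h : k < 2 * r) (i : Fin (r)) :
    cv r k h (zvec r i) = if k = (i : ℕ) then 1 else 0 := by
  simp only [cv, cf_app, zvec_app]
  split_ifs <;> first | omega | norm_num

theorem cw_uvec (r k : ℕ) (h : k < r) (i : Fin (2 * r)) :
    cw r k h (uvec r i) = 0 := by
  simp only [cw, cf_app, uvec_app]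
  split_ifs <;> first | omega | norm_num

theorem cw_uLast (r k : ℕ) (h : k < r) :
    cw r k h (uLast r) = 0 := by
  simp only [cw, cf_app, uLast_app]
  split_ifs <;> first | omega | norm_num

theorem cw_vvec (r k : ℕ) (h : k < r) (i : Fin (2 * r)) :
    cw r k h (vvec r i) = 0 := by
  simp only [cw, cf_app, vvec_app]
  split_ifs <;> first | omega | norm_num

theorem cw_vLast (r k : ℕ) (h : k < r) :
    cw r k h (vLast r) = 0 := by
  simp only [cw, cf_app, vLast_app]
  split_ifs <;> first | omega | norm_num

theorem cw_wvec (r k : ℕ) (h : k < r) (i : Fin (r)) :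
    cw r k h (wvec r i) = if k = (i : ℕ) then 1 else 0 := by
  simp only [cw, cf_app, wvec_app]
  split_ifs <;> first | omega | norm_num

theorem cw_yvec (r k : ℕ) (h : k < r) (i : Fin (r)) :
    cw r k h (yvec r i) = 0 := by
  simp only [cw, cf_app, yvec_app]
  split_ifs <;> first | omega | norm_num

theorem cw_zvec (r k : ℕ) (h : k < r) (i : Fin (r)) :
    cw r k h (zvec r i) = if k = (i : ℕ) then 1 else 0 := by
  simp only [cw, cf_app, zvec_app]
  split_ifs <;> first | omega | norm_num

/-- A functional maximized exactly at the given point. -/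
def sepOf (r : ℕ) (hr : 1 ≤ r) : PIdx r → (EuclideanSpace ℝ (Fin (5 * r)) →ₗ[ℝ] ℝ)
  | .inl i => cu r i (by omega) - (1 / 2 : ℝ) • cv r i (by omega)
  | .inr (.inl _) => -cu r 0 (by omega)
  | .inr (.inr (.inl i)) => cv r i (by omega) - (1 / 2 : ℝ) • cu r i (by omega)
  | .inr (.inr (.inr (.inl _))) => -cv r 0 (by omega)
  | .inr (.inr (.inr (.inr (.inl i)))) => cw r i (by omega) - (1 / 2 : ℝ) • cu r i (by omega)
  | .inr (.inr (.inr (.inr (.inr (.inl i))))) => -cw r i (by omega)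
  | .inr (.inr (.inr (.inr (.inr (.inr (.inl i)))))) =>
      cu r i (by omega) + cv r i (by omega) - (1 / 2 : ℝ) • cw r i (by omega)
  | .inr (.inr (.inr (.inr (.inr (.inr (.inr i)))))) =>
      cu r i (by omega) + cv r i (by omega) + cw r i (by omega)

set_option maxHeartbeats 4000000 in
theorem sep_lt (r : ℕ) (hr : 1 ≤ r) (a b : PIdx r) (hab : b ≠ a) :
    sepOf r hr a (ptOf r b) < sepOf r hr a (ptOf r a) := by
  rcases a with a | a | a | a | a | a | a | a <;>
  rcases b with b | b | b | b | b | b | b | b <;>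
  simp only [ne_eq, Sum.inl.injEq, Sum.inr.injEq, Fin.ext_iff, not_true_eq_false, reduceCtorEq,
    not_false_eq_true] at hab <;>
  simp only [sepOf, ptOf, LinearMap.sub_apply, LinearMap.add_apply, LinearMap.neg_apply,
    LinearMap.smul_apply, smul_eq_mul, map_neg, if_true,
    cu_uvec, cu_uLast, cu_vvec, cu_vLast, cu_wvec, cu_yvec, cu_zvec,
    cv_uvec, cv_uLast, cv_vvec, cv_vLast, cv_wvec, cv_yvec, cv_zvec,
    cw_uvec, cw_uLast, cw_vvec, cw_vLast, cw_wvec, cw_yvec, cw_zvec] <;>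
  first
  | exact absurd rfl hab
  | norm_num; done
  | (split_ifs <;> first | omega | norm_num)

theorem ptOf_inj (r : ℕ) (hr : 1 ≤ r) : Function.Injective (ptOf r) := by
  intro a b h
  by_contra hne
  have := sep_lt r hr b a hne
  rw [h] at this
  exact lt_irrefl _ this

theorem hull_cases (r : ℕ) (hr : 1 ≤ r) (a : PIdx r) (x : EuclideanSpace ℝ (Fin (5 * r)))
    (hx : x ∈ convexHull ℝ (Vr r)) :
    x = ptOf r a ∨ sepOf r hr a x < sepOf r hr a (ptOf r a) := by
  have hsub : Vr r ⊆ {x | x = ptOf r a ∨ sepOf r hr a x < sepOf r hr a (ptOf r a)} := by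
    rw [← range_ptOf]
    rintro _ ⟨b, rfl⟩
    by_cases h : b = a
    · exact Or.inl (by rw [h])
    · exact Or.inr (sep_lt r hr a b h)
  refine convexHull_min hsub ?_ hx
  rw [convex_iff_forall_pos]
  intro x hx y hy s t hs ht hst
  have hle : ∀ z, z = ptOf r a ∨ sepOf r hr a z < sepOf r hr a (ptOf r a) →
      sepOf r hr a z ≤ sepOf r hr a (ptOf r a) := by
    rintro z (rfl | h)
    exacts [le_rfl, h.le]
  have hx' := hle x hx
  have hy' := hle y hy
  have hs' : s = 1 - t := by linarith
  subst hs'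
  rcases hx with rfl | hx
  · rcases hy with rfl | hy
    · left
      rw [← add_smul, hst, one_smul]
    · right
      simp only [map_add, map_smul, smul_eq_mul]
      nlinarith
  · right
    simp only [map_add, map_smul, smul_eq_mul]
    nlinarith

theorem extreme_of_mem (r : ℕ) (hr : 1 ≤ r) (a : PIdx r) :
    ptOf r a ∈ Set.extremePoints ℝ (convexHull ℝ (Vr r)) := by
  rw [mem_extremePoints_iff_left]
  refine ⟨subset_convexHull ℝ _ (by rw [← range_ptOf]; exact ⟨a, rfl⟩), ?_⟩
  rintro x hx y hy ⟨s, t, hs, ht, hst, h⟩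
  rcases hull_cases r hr a x hx with h1 | h1
  · exact h1
  exfalso
  have hy' : sepOf r hr a y ≤ sepOf r hr a (ptOf r a) := by
    rcases hull_cases r hr a y hy with h2 | h2
    · rw [h2]
    · exact h2.le
  have h3 := congrArg (sepOf r hr a) h
  simp only [map_add, map_smul, smul_eq_mul] at h3
  have hs' : s = 1 - t := by linarith
  subst hs'
  nlinarith

/-- Points of the axis. -/
theorem axis_mem {E : Type*} [AddCommGroup E] [Module ℝ E] {C : Set E} (hC : Convex ℝ C)
    (h0 : (0 : E) ∈ C) {e : E} {ε : ℝ} (hε : 0 < ε) (hε1 : ε ≤ 1) (he : e ∈ C)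
    (he' : (-ε) • e ∈ C) (t : ℝ) (ht : |t| ≤ ε) : t • e ∈ C := by
  rw [abs_le] at ht
  rcases le_total 0 t with h | h
  · exact hC.smul_mem_of_zero_mem h0 he ⟨h, by linarith⟩
  · have := hC.smul_mem_of_zero_mem h0 he' (t := -t / ε)
      ⟨by apply div_nonneg <;> linarith, by rw [div_le_one hε]; linarith⟩
    rw [smul_smul] at this
    convert this using 2
    field_simp

theorem neg_mem_of_sum {E : Type*} [AddCommGroup E] [Module ℝ E] {C : Set E} (hC : Convex ℝ C)
    {n : ℕ} (hn : 0 < n) (f : Fin n → E) (hf : ∀ i, f i ∈ C) (hl : -(∑ i, f i) ∈ C) (j : Fin n) :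
    (-(1 / (n : ℝ))) • f j ∈ C := by
  have hn' : (n : ℝ) ≠ 0 := by positivity
  have := hC.sum_mem (t := Finset.univ) (w := fun _ : Fin n => 1 / (n : ℝ))
    (z := fun i => if i = j then -(∑ i, f i) else f i) (fun _ _ => by positivity)
    (by simp [hn']) (fun i _ => by split_ifs; exacts [hl, hf i])
  convert this using 1
  rw [← Finset.smul_sum, neg_smul, ← smul_neg]
  congr 1
  rw [← Finset.add_sum_erase _ _ (Finset.mem_univ j), if_pos rfl,
    ← Finset.add_sum_erase _ f (Finset.mem_univ j),
    Finset.sum_congr rfl (g := f) (fun i hi => if_neg (Finset.ne_of_mem_erase hi))]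
  abel

theorem zero_mem_int (r : ℕ) (hr : 1 ≤ r) :
    (0 : EuclideanSpace ℝ (Fin (5 * r))) ∈ interior (convexHull ℝ (Vr r)) := by
  set C := convexHull ℝ (Vr r) with hCdef
  have hC : Convex ℝ C := convex_convexHull ℝ _
  have hpt : ∀ a, ptOf r a ∈ C := fun a =>
    subset_convexHull ℝ _ (by rw [← range_ptOf]; exact ⟨a, rfl⟩)
  have hu : ∀ i, uvec r i ∈ C := fun i => hpt (.inl i)
  have hul : uLast r ∈ C := hpt (.inr (.inl ()))
  have hv : ∀ i, vvec r i ∈ C := fun i => hpt (.inr (.inr (.inl i)))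
  have hvl : vLast r ∈ C := hpt (.inr (.inr (.inr (.inl ()))))
  have hw : ∀ i, wvec r i ∈ C := fun i => hpt (.inr (.inr (.inr (.inr (.inl i)))))
  have hw' : ∀ i, -wvec r i ∈ C := fun i => hpt (.inr (.inr (.inr (.inr (.inr (.inl i))))))
  have h0 : (0 : EuclideanSpace ℝ (Fin (5 * r))) ∈ C := by
    have := hC (hw ⟨0, hr⟩) (hw' ⟨0, hr⟩) (a := 1 / 2) (b := 1 / 2) (by norm_num) (by norm_num)
      (by norm_num)
    simpa using this
  set ε : ℝ := 1 / ((2 * r : ℕ) : ℝ) with hεdef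
  have hr2 : (1 : ℝ) ≤ ((2 * r : ℕ) : ℝ) := by exact_mod_cast (by omega : 1 ≤ 2 * r)
  have hε : 0 < ε := by positivity
  have hε1 : ε ≤ 1 := by rw [hεdef, div_le_one (by linarith)]; exact hr2
  have hax : ∀ (k : Fin (5 * r)) (t : ℝ), |t| ≤ ε → t • EuclideanSpace.single k (1 : ℝ) ∈ C := by
    intro k t ht
    have hk := k.isLt
    by_cases h1 : (k : ℕ) < 2 * r
    · exact axis_mem hC h0 hε hε1 (hu ⟨k, h1⟩)
        (neg_mem_of_sum hC (by omega) (uvec r) hu hul ⟨k, h1⟩) t ht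
    by_cases h2 : (k : ℕ) < 4 * r
    · have := axis_mem hC h0 hε hε1 (hv ⟨k - 2 * r, by omega⟩)
        (neg_mem_of_sum hC (by omega) (vvec r) hv hvl ⟨k - 2 * r, by omega⟩) t ht
      convert this using 2
      unfold vvec
      congr 1
      ext
      simp only
      omega
    · have h3 := hC.smul_mem_of_zero_mem h0 (hw' ⟨k - 4 * r, by omega⟩) ⟨hε.le, hε1⟩
      rw [smul_neg, ← neg_smul] at h3
      have := axis_mem hC h0 hε hε1 (hw ⟨k - 4 * r, by omega⟩) h3 t ht
      convert this using 2
      unfold wvec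
      congr 1
      ext
      simp only
      omega
  have hn : (0 : ℝ) < ((5 * r : ℕ) : ℝ) := by exact_mod_cast (by omega : 0 < 5 * r)
  rw [mem_interior]
  refine ⟨⋂ k : Fin (5 * r), {x | |((5 * r : ℕ) : ℝ) * x k| < ε}, ?_, ?_, ?_⟩
  · intro x hx
    rw [Set.mem_iInter] at hx
    have hsum : ∑ _k : Fin (5 * r), 1 / ((5 * r : ℕ) : ℝ) = 1 := by
      rw [Finset.sum_const, Finset.card_univ, Fintype.card_fin, nsmul_eq_mul]
      exact mul_one_div_cancel hn.ne'
    have := hC.sum_mem (t := Finset.univ) (w := fun _ : Fin (5 * r) => 1 / ((5 * r : ℕ) : ℝ))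
      (z := fun k => (((5 * r : ℕ) : ℝ) * x k) • EuclideanSpace.single k (1 : ℝ))
      (fun _ _ => by positivity) hsum (fun k _ => hax k _ (hx k).le)
    convert this using 1
    ext j
    simp only [WithLp.ofLp_sum, Finset.sum_apply, PiLp.smul_apply, smul_eq_mul,
      PiLp.single_apply]
    rw [Finset.sum_eq_single j]
    · simp only [if_true]
      field_simp
    · intro b _ hb
      simp [hb.symm]
    · simp
  · apply isOpen_iInter_of_finite
    intro k
    exact isOpen_lt (by fun_prop) continuous_const
  · simp [hε]

theorem stmt6 (r : ℕ) (hr : 1 ≤ r) :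
    (Vr r).ncard = 8 * r + 2 ∧
    (0 : EuclideanSpace ℝ (Fin (5 * r))) ∈ interior (convexHull ℝ (Vr r)) ∧
    Set.extremePoints ℝ (convexHull ℝ (Vr r)) = Vr r := by
  refine ⟨?_, zero_mem_int r hr, ?_⟩
  · rw [← range_ptOf, Set.ncard_range_of_injective (ptOf_inj r hr)]
    simp
    omega
  · apply Set.Subset.antisymm extremePoints_convexHull_subset
    intro x hx
    rw [← range_ptOf] at hx
    obtain ⟨a, rfl⟩ := hx
    exact extreme_of_mem r hr a
end
end

section
/- Fix an integer r ≥ 1 and let e₁, …, e₅ᵣ be the standard basis of ℝ^{5r}. Define the 8r+2 points: uᵢ = eᵢ for 1 ≤ i ≤ 2r, u_{2r+1} = −(e₁+⋯+e_{2r}); vᵢ = e_{2r+i} for 1 ≤ i ≤ 2r, v_{2r+1} = −(e_{2r+1}+⋯+e_{4r}); w_{i,1} = e_{4r+i} and w_{i,2} = −e_{4r+i} for 1 ≤ i ≤ r; yᵢ = uᵢ + vᵢ for 1 ≤ i ≤ r; zᵢ = w_{i,1} + yᵢ for 1 ≤ i ≤ r. Let Δ_r be the convex hull of these 8r+2 points.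 Then for every facet F of Δ_r, the set of the 8r+2 points lying in F has exactly 5r elements and forms a ℤ-basis of the lattice ℤ^{5r} ⊂ ℝ^{5r}. -/
noncomputable section


open Classical in
/-- number of true propositions among six -/
noncomputable def cnt6 (pu pv pw pn py pz : Prop) : ℕ :=
  (if pu then 1 else 0) + (if pv then 1 else 0) + (if pw then 1 else 0) +
  (if pn then 1 else 0) + (if py then 1 else 0) + (if pz then 1 else 0)

theorem cnt6_le (pu pv pw pn py pz : Prop) (huv : ¬ (pu ∧ pv)) (hwn : ¬ (pw ∧ pn))
    (hwy : ¬ (pw ∧ py)) (hzn : ¬ (pz ∧ pn)) : cnt6 pu pv pw pn py pz ≤ 3 := by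
  unfold cnt6
  by_cases h1 : pu <;> by_cases h2 : pv <;> by_cases h3 : pw <;> by_cases h4 : pn <;>
    by_cases h5 : py <;> by_cases h6 : pz <;>
    simp only [h1, h2, h3, h4, h5, h6, if_true, if_false] <;> first | omega | (exfalso; tauto)

theorem cnt6_three (pu pv pw pn py pz : Prop) (huv : ¬ (pu ∧ pv)) (hwn : ¬ (pw ∧ pn))
    (hwy : ¬ (pw ∧ py)) (hzn : ¬ (pz ∧ pn)) (h : cnt6 pu pv pw pn py pz = 3) :
    (pu ∨ pv) ∧ ((pw ∧ pz) ∨ (py ∧ pz) ∨ (py ∧ pn)) := by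
  revert h
  unfold cnt6
  by_cases h1 : pu <;> by_cases h2 : pv <;> by_cases h3 : pw <;> by_cases h4 : pn <;>
    by_cases h5 : py <;> by_cases h6 : pz <;>
    simp only [h1, h2, h3, h4, h5, h6, if_true, if_false] <;> first | omega | tauto

theorem cnt6_two (pu pv pw pn py pz : Prop) (huv : ¬ (pu ∧ pv)) (hwn : ¬ (pw ∧ pn))
    (hwy : ¬ (pw ∧ py)) (hzn : ¬ (pz ∧ pn)) (h : cnt6 pu pv pw pn py pz = 2) :
    (pu ∧ (pw ∨ pn) ∧ ¬ pv ∧ ¬ py ∧ ¬ pz) ∨ (pv ∧ (pw ∨ pn) ∧ ¬ pu ∧ ¬ py ∧ ¬ pz) ∨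
    (pu ∧ py ∧ ¬ pv ∧ ¬ pw ∧ ¬ pn ∧ ¬ pz) ∨ (pv ∧ py ∧ ¬ pu ∧ ¬ pw ∧ ¬ pn ∧ ¬ pz) ∨
    (pu ∧ pz ∧ ¬ pv ∧ ¬ pw ∧ ¬ pn ∧ ¬ py) ∨ (pv ∧ pz ∧ ¬ pu ∧ ¬ pw ∧ ¬ pn ∧ ¬ py) ∨
    (¬ pu ∧ ¬ pv ∧ ((pw ∧ pz) ∨ (py ∧ pz) ∨ (py ∧ pn))) := by
  revert h
  unfold cnt6
  by_cases h1 : pu <;> by_cases h2 : pv <;> by_cases h3 : pw <;> by_cases h4 : pn <;>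
    by_cases h5 : py <;> by_cases h6 : pz <;>
    first
    | exact (huv (And.intro h1 h2)).elim
    | exact (hwn (And.intro h3 h4)).elim
    | exact (hwy (And.intro h3 h5)).elim
    | exact (hzn (And.intro h6 h4)).elim
    | simp [h1, h2, h3, h4, h5, h6]

theorem cnt6_one (pu pv pw pn py pz : Prop) (_h : cnt6 pu pv pw pn py pz = 1) :
    (¬ pw ∧ ¬ pn ∧ ¬ pz) ∨ pw ∨ pn ∨ pz := by
  tauto

/-- Counting bound for a three-dimensional block. -/
theorem count3 (a b c : ℝ) (hw : c ≤ 1) (hn : -c ≤ 1) (hu : a ≤ 1) (hv : b ≤ 1)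
    (hy : a + b ≤ 1) (hz : c + (a + b) ≤ 1) (n : ℕ)
    (h : n = cnt6 (a = 1) (b = 1) (c = 1) (-c = 1) (a + b = 1) (c + (a + b) = 1)) :
    n ≤ 3 ∧ (n = 3 → -1 ≤ a ∧ -1 ≤ b) ∧ (n = 2 → -1 ≤ a ∨ -1 ≤ b) := by
  subst h
  have x1 : ¬ (a = 1 ∧ b = 1) := fun h => by linarith [h.1, h.2]
  have x2 : ¬ (c = 1 ∧ -c = 1) := fun h => by linarith [h.1, h.2]
  have x3 : ¬ (c = 1 ∧ a + b = 1) := fun h => by linarith [h.1, h.2]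
  have x4 : ¬ (c + (a + b) = 1 ∧ -c = 1) := fun h => by linarith [h.1, h.2]
  refine ⟨cnt6_le _ _ _ _ _ _ x1 x2 x3 x4, fun h => ?_, fun h => ?_⟩
  · rcases cnt6_three _ _ _ _ _ _ x1 x2 x3 x4 h with ⟨h | h, ⟨h1, h2⟩ | ⟨h1, h2⟩ | ⟨h1, h2⟩⟩ <;>
      constructor <;> linarith
  · by_contra! hh
    obtain ⟨k1, k2⟩ := hh
    rcases cnt6_two _ _ _ _ _ _ x1 x2 x3 x4 h with h | h | h | h | h | h | ⟨-, -, h | h | h⟩ <;>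
      first | linarith [h.1] | linarith [h.1, h.2]

theorem count2 (a b : ℝ) (_hu : a ≤ 1) (_hv : b ≤ 1) (n : ℕ)
    (h : n = cnt6 (a = 1) (b = 1) False False False False) :
    n ≤ 2 ∧ (n = 2 → 1 ≤ a ∧ 1 ≤ b) ∧ (n = 1 → 1 ≤ a ∨ 1 ≤ b) := by
  subst h
  unfold cnt6
  by_cases h1 : a = 1 <;> by_cases h2 : b = 1 <;> simp [h1, h2]

/-- Admissible pairs. -/
def Adm (α β : ℤ) : Prop :=
  (α = 1 ∧ β = 0) ∨ (α = 0 ∧ β = 1) ∨ (α = 1 ∧ β = -1) ∨ (α = 0 ∧ β = 0)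

def Kills (pu pv pw pn py pz : Prop) (α β γ : ℤ) : Prop :=
  (pu → α = 0) ∧ (pv → β = 0) ∧ (pw → γ = 0) ∧ (pn → γ = 0) ∧ (py → α + β = 0) ∧
    (pz → γ + (α + β) = 0)

theorem struct3 {M : Type*} [AddCommGroup M] (L : Submodule ℤ M) (u v w : M)
    (pu pv pw pn py pz : Prop) (huv : ¬ (pu ∧ pv)) (hwn : ¬ (pw ∧ pn)) (hwy : ¬ (pw ∧ py))
    (hzn : ¬ (pz ∧ pn)) (hu : pu → u ∈ L) (hv : pv → v ∈ L) (hw : pw → w ∈ L)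
    (hn : pn → -w ∈ L) (hy : py → u + v ∈ L) (hz : pz → w + (u + v) ∈ L) (n : ℕ)
    (h : n = cnt6 pu pv pw pn py pz) :
    (n = 3 → u ∈ L ∧ v ∈ L ∧ w ∈ L) ∧
    (n = 2 → ∃ α β γ : ℤ, ∃ g : M, Adm α β ∧ Kills pu pv pw pn py pz α β γ ∧
      (α ≠ 0 ∨ β ≠ 0 ∨ γ ≠ 0) ∧ u - α • g ∈ L ∧ v - β • g ∈ L ∧ w - γ • g ∈ L) ∧
    (n = 1 → Kills pu pv pw pn py pz 0 0 1 ∨ (u ∈ L → v ∈ L → w ∈ L)) := by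
  subst h
  have e1 : u ∈ L → u + v ∈ L → v ∈ L := fun h1 h2 => by
    have := L.sub_mem h2 h1; rwa [show u + v - u = v by abel] at this
  have e2 : v ∈ L → u + v ∈ L → u ∈ L := fun h1 h2 => by
    have := L.sub_mem h2 h1; rwa [show u + v - v = u by abel] at this
  have e3 : u + v ∈ L → w + (u + v) ∈ L → w ∈ L := fun h1 h2 => by
    have := L.sub_mem h2 h1; rwa [show w + (u + v) - (u + v) = w by abel] at this
  have e4 : w ∈ L → w + (u + v) ∈ L → u + v ∈ L := fun h1 h2 => by
    have := L.sub_mem h2 h1; rwa [show w + (u + v) - w = u + v by abel] at this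
  have e5 : -w ∈ L → w ∈ L := fun h => by simpa using h
  have e6 : u ∈ L → v ∈ L → u + v ∈ L := fun h h' => L.add_mem h h'
  have e7 : u ∈ L → w + (u + v) ∈ L → v + w ∈ L := fun h1 h2 => by
    have := L.sub_mem h2 h1; rwa [show w + (u + v) - u = v + w by abel] at this
  have e8 : v ∈ L → w + (u + v) ∈ L → u + w ∈ L := fun h1 h2 => by
    have := L.sub_mem h2 h1; rwa [show w + (u + v) - v = u + w by abel] at this
  have c1 : v + u = u + v := add_comm _ _
  have c2 : w + u = u + w := add_comm _ _
  have c3 : w + v = v + w := add_comm _ _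
  refine ⟨?_, ?_, ?_⟩
  · intro h
    have h' := cnt6_three _ _ _ _ _ _ huv hwn hwy hzn h
    have k1 : u + v ∈ L ∧ w ∈ L := by
      rcases h'.2 with h | h | h
      · exact ⟨e4 (hw h.1) (hz h.2), hw h.1⟩
      · exact ⟨hy h.1, e3 (hy h.1) (hz h.2)⟩
      · exact ⟨hy h.1, e5 (hn h.2)⟩
    rcases h'.1 with h | h
    · exact ⟨hu h, e1 (hu h) k1.1, k1.2⟩
    · exact ⟨e2 (hv h) k1.1, hv h, k1.2⟩
  · intro hc
    have key : (v ∈ L ∧ w ∈ L ∧ Kills pu pv pw pn py pz 1 0 0) ∨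
        (u ∈ L ∧ w ∈ L ∧ Kills pu pv pw pn py pz 0 1 0) ∨
        (u ∈ L ∧ v ∈ L ∧ Kills pu pv pw pn py pz 0 0 1) ∨
        (u ∈ L ∧ v + w ∈ L ∧ Kills pu pv pw pn py pz 0 1 (-1)) ∨
        (v ∈ L ∧ u + w ∈ L ∧ Kills pu pv pw pn py pz 1 0 (-1)) ∨
        (u + v ∈ L ∧ w ∈ L ∧ Kills pu pv pw pn py pz 1 (-1) 0) := by
      unfold Kills
      rcases cnt6_two _ _ _ _ _ _ huv hwn hwy hzn hc with
        ⟨h1, h2, h3, h4, h5⟩ | ⟨h1, h2, h3, h4, h5⟩ | ⟨h1, h2, h3, h4, h5, h6⟩ |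
        ⟨h1, h2, h3, h4, h5, h6⟩ | ⟨h1, h2, h3, h4, h5, h6⟩ | ⟨h1, h2, h3, h4, h5, h6⟩ |
        ⟨h1, h2, h3⟩
      · exact .inr (.inl ⟨hu h1, h2.elim hw (fun h => e5 (hn h)), by simp [h3, h4, h5]⟩)
      · exact .inl ⟨hv h1, h2.elim hw (fun h => e5 (hn h)), by simp [h3, h4, h5]⟩
      · exact .inr (.inr (.inl ⟨hu h1, e1 (hu h1) (hy h2), by simp [h3, h4, h5, h6]⟩))
      · exact .inr (.inr (.inl ⟨e2 (hv h1) (hy h2), hv h1, by simp [h3, h4, h5, h6]⟩))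
      · exact .inr (.inr (.inr (.inl ⟨hu h1, e7 (hu h1) (hz h2), by simp [h3, h4, h5, h6]⟩)))
      · exact .inr (.inr (.inr (.inr (.inl
          ⟨hv h1, e8 (hv h1) (hz h2), by simp [h3, h4, h5, h6]⟩))))
      · refine .inr (.inr (.inr (.inr (.inr ?_))))
        rcases h3 with h | h | h
        · exact ⟨e4 (hw h.1) (hz h.2), hw h.1, by simp [h1, h2]⟩
        · exact ⟨hy h.1, e3 (hy h.1) (hz h.2), by simp [h1, h2]⟩
        · exact ⟨hy h.1, e5 (hn h.2), by simp [h1, h2]⟩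
    rcases key with h | h | h | h | h | h
    · exact ⟨1, 0, 0, u, by simp [Adm], h.2.2, by simp, by simp, by simpa using h.1, by simpa using h.2.1⟩
    · exact ⟨0, 1, 0, v, by simp [Adm], h.2.2, by simp, by simpa using h.1, by simp, by simpa using h.2.1⟩
    · exact ⟨0, 0, 1, w, by simp [Adm], h.2.2, by simp, by simpa using h.1, by simpa using h.2.1, by simp⟩
    · exact ⟨0, 1, -1, v, by simp [Adm], h.2.2, by simp, by simpa using h.1, by simp,
        by simpa [c3] using h.2.1⟩
    · exact ⟨1, 0, -1, u, by simp [Adm], h.2.2, by simp, by simp, by simpa using h.1,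
        by simpa [c2] using h.2.1⟩
    · exact ⟨1, -1, 0, u, by simp [Adm], h.2.2, by simp, by simp, by simpa [c1] using h.1,
        by simpa using h.2.1⟩
  · intro h
    rcases cnt6_one _ _ _ _ _ _ h with h | h | h | h
    · left; simp [Kills, h]
    · right; exact fun _ _ => hw h
    · right; exact fun _ _ => e5 (hn h)
    · right; exact fun h1 h2 => e3 (e6 h1 h2) (hz h)

theorem struct2 {M : Type*} [AddCommGroup M] (L : Submodule ℤ M) (u v w : M) (hw : w = 0)
    (pu pv : Prop) (hu : pu → u ∈ L) (hv : pv → v ∈ L) (n : ℕ)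
    (h : n = cnt6 pu pv False False False False) :
    (n = 2 → u ∈ L ∧ v ∈ L ∧ w ∈ L) ∧
    (n = 1 → ∃ α β γ : ℤ, ∃ g : M, γ = 0 ∧ Adm α β ∧ Kills pu pv False False False False α β γ ∧
      (α ≠ 0 ∨ β ≠ 0 ∨ γ ≠ 0) ∧ u - α • g ∈ L ∧ v - β • g ∈ L ∧ w - γ • g ∈ L) := by
  subst h hw
  unfold cnt6 Kills
  by_cases h1 : pu <;> by_cases h2 : pv <;>
    simp only [h1, h2, if_true, if_false] <;> refine ⟨fun h => ?_, fun h => ?_⟩ <;> try omega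
  · exact ⟨hu h1, hv h2, L.zero_mem⟩
  · exact ⟨0, 1, 0, v, by simp, by simp [Adm], by simp, by simp, by simpa using hu h1, by simp,
      by simp⟩
  · exact ⟨1, 0, 0, u, by simp, by simp [Adm], by simp, by simp, by simp, by simpa using hv h2,
      by simp⟩

theorem sum_two {J : Type*} [Fintype J] [DecidableEq J] (d : J → ℕ) (h : ∑ j, d j = 2) :
    (∃ i, d i = 2 ∧ ∀ k, k ≠ i → d k = 0) ∨
    (∃ i j, i ≠ j ∧ d i = 1 ∧ d j = 1 ∧ ∀ k, k ≠ i → k ≠ j → d k = 0) := by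
  obtain ⟨i, -, hi⟩ : ∃ i ∈ Finset.univ, d i ≠ 0 := by
    apply Finset.exists_ne_zero_of_sum_ne_zero; omega
  have h1 := Finset.add_sum_erase Finset.univ d (Finset.mem_univ i)
  by_cases hi2 : d i = 2
  · left
    refine ⟨i, hi2, fun k hk => ?_⟩
    have : ∑ x ∈ Finset.univ.erase i, d x = 0 := by omega
    rw [Finset.sum_eq_zero_iff] at this
    exact this k (by simp [hk])
  · right
    have hs : ∑ x ∈ Finset.univ.erase i, d x = 1 := by omega
    obtain ⟨j, hj, hj0⟩ : ∃ j ∈ Finset.univ.erase i, d j ≠ 0 := by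
      apply Finset.exists_ne_zero_of_sum_ne_zero; omega
    have h2 := Finset.add_sum_erase _ d hj
    refine ⟨i, j, (Finset.ne_of_mem_erase hj).symm, by omega, by omega, fun k hk hk' => ?_⟩
    have : ∑ x ∈ (Finset.univ.erase i).erase j, d x = 0 := by omega
    rw [Finset.sum_eq_zero_iff] at this
    exact this k (by simp [hk, hk'])

theorem adm_det (α β α' β' : ℤ) (h : Adm α β) (h' : Adm α' β') :
    (∃ x y z t : ℤ, x * α + y * β = 1 ∧ x * α' + y * β' = 0 ∧ z * α + t * β = 0 ∧
      z * α' + t * β' = 1) ∨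
    (∃ x y : ℤ, (x ≠ 0 ∨ y ≠ 0) ∧ x * α + y * α' = 0 ∧ x * β + y * β' = 0) := by
  rcases h with ⟨rfl, rfl⟩ | ⟨rfl, rfl⟩ | ⟨rfl, rfl⟩ | ⟨rfl, rfl⟩ <;>
  rcases h' with ⟨rfl, rfl⟩ | ⟨rfl, rfl⟩ | ⟨rfl, rfl⟩ | ⟨rfl, rfl⟩ <;>
  first
  | (refine Or.inr ⟨1, 0, ?_, ?_, ?_⟩ <;> decide)
  | (refine Or.inr ⟨0, 1, ?_, ?_, ?_⟩ <;> decide)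
  | (refine Or.inr ⟨1, -1, ?_, ?_, ?_⟩ <;> decide)
  | (refine Or.inl ⟨1, 0, 0, 1, ?_, ?_, ?_, ?_⟩ <;> decide)
  | (refine Or.inl ⟨0, 1, 1, 0, ?_, ?_, ?_, ?_⟩ <;> decide)
  | (refine Or.inl ⟨1, 1, 0, -1, ?_, ?_, ?_, ?_⟩ <;> decide)
  | (refine Or.inl ⟨0, -1, 1, 1, ?_, ?_, ?_, ?_⟩ <;> decide)
  | (refine Or.inl ⟨1, 1, 1, 0, ?_, ?_, ?_, ?_⟩ <;> decide)
  | (refine Or.inl ⟨1, 0, 1, 1, ?_, ?_, ?_, ?_⟩ <;> decide)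

/-- The abstract point set. -/
def Pts {E J : Type*} [AddCommGroup E] (s : J → Prop) (U V W : J → E) : Set E :=
  {x | ∃ j, x = U j ∨ x = V j ∨ (s j ∧ (x = W j ∨ x = -W j ∨ x = U j + V j ∨
    x = W j + (U j + V j)))}

open Classical in
theorem card_six {E : Type*} (p1 p2 p3 p4 p5 p6 : Prop) (x1 x2 x3 x4 x5 x6 : E) :
    ∃ S : Finset E, S.card ≤ cnt6 p1 p2 p3 p4 p5 p6 ∧
      ∀ x, x ∈ S ↔ (p1 ∧ x = x1) ∨ (p2 ∧ x = x2) ∨ (p3 ∧ x = x3) ∨ (p4 ∧ x = x4) ∨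
        (p5 ∧ x = x5) ∨ (p6 ∧ x = x6) := by
  let f : Prop → E → Finset E := fun p x => if p then {x} else ∅
  have hf : ∀ p x, (f p x).card ≤ if p then 1 else 0 := by
    intro p x; by_cases h : p <;> simp [f, h]
  have hm : ∀ p x y, y ∈ f p x ↔ p ∧ y = x := by
    intro p x y; by_cases h : p <;> simp [f, h]
  refine ⟨f p1 x1 ∪ (f p2 x2 ∪ (f p3 x3 ∪ (f p4 x4 ∪ (f p5 x5 ∪ f p6 x6)))), ?_, ?_⟩
  · unfold cnt6
    have h1 := Finset.card_union_le (f p1 x1) (f p2 x2 ∪ (f p3 x3 ∪ (f p4 x4 ∪ (f p5 x5 ∪ f p6 x6))))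
    have h2 := Finset.card_union_le (f p2 x2) (f p3 x3 ∪ (f p4 x4 ∪ (f p5 x5 ∪ f p6 x6)))
    have h3 := Finset.card_union_le (f p3 x3) (f p4 x4 ∪ (f p5 x5 ∪ f p6 x6))
    have h4 := Finset.card_union_le (f p4 x4) (f p5 x5 ∪ f p6 x6)
    have h5 := Finset.card_union_le (f p5 x5) (f p6 x6)
    linarith [hf p1 x1, hf p2 x2, hf p3 x3, hf p4 x4, hf p5 x5, hf p6 x6]
  · intro x
    simp only [Finset.mem_union, hm]

set_option maxHeartbeats 1000000 in
open Classical in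
theorem core {E J : Type*} [AddCommGroup E] [Module ℝ E] [FiniteDimensional ℝ E] [Fintype J]
    (s : J → Prop) (U V W : J → E) (hU : ∑ j, U j = 0) (hV : ∑ j, V j = 0)
    (hW : ∀ j, ¬ s j → W j = 0)
    (hext : ∀ A B C : J → ℝ, ∑ j, A j = 0 → ∑ j, B j = 0 → (∀ j, ¬ s j → C j = 0) →
      ∃ f : E →ₗ[ℝ] ℝ, ∀ j, f (U j) = A j ∧ f (V j) = B j ∧ f (W j) = C j)
    (hm : 0 < ∑ j, (if s j then (-1 : ℝ) else 1))
    (l : E →ₗ[ℝ] ℝ) (T : Set E) (hT : ∀ x, x ∈ T ↔ x ∈ Pts s U V W ∧ l x = 1)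
    (hle : ∀ x ∈ Pts s U V W, l x ≤ 1) (hspan : Submodule.span ℝ T = ⊤) (N : ℕ)
    (hN : ∑ j, (if s j then 3 else 2) = N + 2) (hfin : Module.finrank ℝ E = N) :
    T.ncard = N ∧ ∀ j, U j ∈ Submodule.span ℤ T ∧ V j ∈ Submodule.span ℤ T ∧
      W j ∈ Submodule.span ℤ T := by
  -- membership facts
  have pU : ∀ j, U j ∈ Pts s U V W := fun j => ⟨j, by simp⟩
  have pV : ∀ j, V j ∈ Pts s U V W := fun j => ⟨j, by simp⟩
  have pW : ∀ j, s j → W j ∈ Pts s U V W := fun j h => ⟨j, by simp [h]⟩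
  have pn : ∀ j, s j → -W j ∈ Pts s U V W := fun j h => ⟨j, by simp [h]⟩
  have py : ∀ j, s j → U j + V j ∈ Pts s U V W := fun j h => ⟨j, by simp [h]⟩
  have pz : ∀ j, s j → W j + (U j + V j) ∈ Pts s U V W := fun j h => ⟨j, by simp [h]⟩
  set L := Submodule.span ℤ T with hL
  have tL : ∀ x ∈ Pts s U V W, l x = 1 → x ∈ L := fun x hx h =>
    Submodule.subset_span ((hT x).2 ⟨hx, h⟩)
  -- counts
  let n : J → ℕ := fun j => cnt6 (l (U j) = 1) (l (V j) = 1) (s j ∧ l (W j) = 1)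
    (s j ∧ -l (W j) = 1) (s j ∧ l (U j) + l (V j) = 1) (s j ∧ l (W j) + (l (U j) + l (V j)) = 1)
  let D : J → ℕ := fun j => if s j then 3 else 2
  have n3 : ∀ j, s j → n j = cnt6 (l (U j) = 1) (l (V j) = 1) (l (W j) = 1)
    (-l (W j) = 1) (l (U j) + l (V j) = 1) (l (W j) + (l (U j) + l (V j)) = 1) := by
    intro j h; simp only [n, h, true_and]
  have n2 : ∀ j, ¬ s j → n j = cnt6 (l (U j) = 1) (l (V j) = 1) False False False False := by
    intro j h; simp only [n, h, false_and]
  have bU : ∀ j, l (U j) ≤ 1 := fun j => hle _ (pU j)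
  have bV : ∀ j, l (V j) ≤ 1 := fun j => hle _ (pV j)
  have bW : ∀ j, s j → l (W j) ≤ 1 := fun j h => hle _ (pW j h)
  have bn : ∀ j, s j → -l (W j) ≤ 1 := fun j h => by simpa using hle _ (pn j h)
  have bY : ∀ j, s j → l (U j) + l (V j) ≤ 1 := fun j h => by simpa using hle _ (py j h)
  have bZ : ∀ j, s j → l (W j) + (l (U j) + l (V j)) ≤ 1 := fun j h => by
    simpa using hle _ (pz j h)
  have hcount : ∀ j, n j ≤ D j ∧
      (n j = D j → (if s j then (-1 : ℝ) else 1) ≤ l (U j) ∧ (if s j then (-1 : ℝ) else 1) ≤ l (V j)) ∧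
      (n j + 1 = D j →
        (if s j then (-1 : ℝ) else 1) ≤ l (U j) ∨ (if s j then (-1 : ℝ) else 1) ≤ l (V j)) := by
    intro j
    by_cases h : s j
    · have := count3 _ _ _ (bW j h) (bn j h) (bU j) (bV j) (bY j h) (bZ j h) (n j) (n3 j h)
      simp only [D, h, if_true]
      exact ⟨this.1, this.2.1, fun h => this.2.2 (by omega)⟩
    · have := count2 _ _ (bU j) (bV j) (n j) (n2 j h)
      simp only [D, h, if_false]
      exact ⟨this.1, this.2.1, fun h => this.2.2 (by omega)⟩
  -- T is small
  have hTfin : ∃ S : Finset E, (S : Set E) = T ∧ S.card ≤ ∑ j, n j := by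
    choose S hS1 hS2 using fun j => card_six (l (U j) = 1) (l (V j) = 1) (s j ∧ l (W j) = 1)
      (s j ∧ -l (W j) = 1) (s j ∧ l (U j) + l (V j) = 1)
      (s j ∧ l (W j) + (l (U j) + l (V j)) = 1) (U j) (V j) (W j) (-W j) (U j + V j)
      (W j + (U j + V j))
    refine ⟨Finset.univ.biUnion S, ?_, Finset.card_biUnion_le.trans
      (Finset.sum_le_sum fun j _ => hS1 j)⟩
    ext x
    rw [hT]
    simp only [Finset.coe_biUnion, Finset.coe_univ, Set.mem_univ, Set.iUnion_true, Set.mem_iUnion,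
      Finset.mem_coe, hS2, Pts, Set.mem_ofPred_eq]
    constructor
    · rintro ⟨j, ⟨h, rfl⟩ | ⟨h, rfl⟩ | ⟨⟨h', h⟩, rfl⟩ | ⟨⟨h', h⟩, rfl⟩ | ⟨⟨h', h⟩, rfl⟩ | ⟨⟨h', h⟩, rfl⟩⟩
      · exact ⟨⟨j, by simp⟩, h⟩
      · exact ⟨⟨j, by simp⟩, h⟩
      · exact ⟨⟨j, by simp [h']⟩, h⟩
      · exact ⟨⟨j, by simp [h']⟩, by simpa using h⟩
      · exact ⟨⟨j, by simp [h']⟩, by simpa using h⟩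
      · exact ⟨⟨j, by simp [h']⟩, by simpa using h⟩
    · rintro ⟨⟨j, rfl | rfl | ⟨h', rfl | rfl | rfl | rfl⟩⟩, h⟩
      · exact ⟨j, .inl ⟨h, rfl⟩⟩
      · exact ⟨j, .inr (.inl ⟨h, rfl⟩)⟩
      · exact ⟨j, .inr (.inr (.inl ⟨⟨h', h⟩, rfl⟩))⟩
      · exact ⟨j, .inr (.inr (.inr (.inl ⟨⟨h', by simpa using h⟩, rfl⟩)))⟩
      · exact ⟨j, .inr (.inr (.inr (.inr (.inl ⟨⟨h', by simpa using h⟩, rfl⟩))))⟩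
      · exact ⟨j, .inr (.inr (.inr (.inr (.inr ⟨⟨h', by simpa using h⟩, rfl⟩))))⟩
  obtain ⟨S, hS, hScard⟩ := hTfin
  have hge : N ≤ S.card := by
    have := finrank_span_finset_le_card (R := ℝ) S
    rw [Set.finrank, hS, hspan, finrank_top, hfin] at this
    exact this
  let d : J → ℕ := fun j => D j - n j
  have hd : ∀ j, n j + d j = D j := fun j => by have := (hcount j).1; simp only [d]; omega
  have hdsum : ∑ j, n j + ∑ j, d j = N + 2 := by
    rw [← Finset.sum_add_distrib, ← hN]; exact Finset.sum_congr rfl fun j _ => hd j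
  have lU : ∑ j, l (U j) = 0 := by rw [← map_sum, hU, map_zero]
  have lV : ∑ j, l (V j) = 0 := by rw [← map_sum, hV, map_zero]
  -- deficiency at least two
  have hd2 : 2 ≤ ∑ j, d j := by
    by_contra hlt
    have hsmall : ∀ i, (∀ k, k ≠ i → d k = 0) ∧ d i ≤ 1 ∨ d i = 0 := by
      intro i
      by_cases hi : d i = 0
      · exact .inr hi
      · left
        have h1 := Finset.add_sum_erase Finset.univ d (Finset.mem_univ i)
        refine ⟨fun k hk => ?_, by omega⟩
        have : ∑ x ∈ Finset.univ.erase i, d x = 0 := by omega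
        rw [Finset.sum_eq_zero_iff] at this
        exact this k (by simp [hk])
    have hz : ∀ k, d k = 0 → (if s k then (-1 : ℝ) else 1) ≤ l (U k) ∧
        (if s k then (-1 : ℝ) else 1) ≤ l (V k) := fun k hk =>
      (hcount k).2.1 (by have := hd k; omega)
    have hor : (∀ j, (if s j then (-1 : ℝ) else 1) ≤ l (U j)) ∨
        (∀ j, (if s j then (-1 : ℝ) else 1) ≤ l (V j)) := by
      by_cases hall : ∀ i, d i = 0
      · exact .inl fun j => (hz j (hall j)).1
      · push Not at hall
        obtain ⟨i, hi⟩ := hall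
        obtain ⟨h1, h2⟩ := (hsmall i).resolve_right hi
        rcases (hcount i).2.2 (by have := hd i; omega) with h | h
        · left; intro j
          by_cases hj : j = i
          · exact hj ▸ h
          · exact (hz j (h1 j hj)).1
        · right; intro j
          by_cases hj : j = i
          · exact hj ▸ h
          · exact (hz j (h1 j hj)).2
    rcases hor with h | h
    · have := Finset.sum_le_sum fun j (_ : j ∈ Finset.univ) => h j
      linarith
    · have := Finset.sum_le_sum fun j (_ : j ∈ Finset.univ) => h j
      linarith
  have hcard : S.card = N := by omega
  have hdeq : ∑ j, d j = 2 := by omega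
  refine ⟨by rw [← hS, Set.ncard_coe_finset, hcard], ?_⟩
  -- structure
  have hs3 := fun j (h : s j) => struct3 L (U j) (V j) (W j) (l (U j) = 1) (l (V j) = 1)
    (l (W j) = 1) (-l (W j) = 1) (l (U j) + l (V j) = 1) (l (W j) + (l (U j) + l (V j)) = 1)
    (fun h' => by linarith [h'.1, h'.2, bY j h]) (fun h' => by linarith [h'.1, h'.2])
    (fun h' => by linarith [h'.1, h'.2, bZ j h])
    (fun h' => by linarith [h'.1, h'.2, bY j h]) (tL _ (pU j)) (tL _ (pV j)) (tL _ (pW j h))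
    (fun h' => tL _ (pn j h) (by simpa using h')) (fun h' => tL _ (py j h) (by simpa using h'))
    (fun h' => tL _ (pz j h) (by simpa using h')) (n j) (n3 j h)
  have hs2 := fun j (h : ¬ s j) => struct2 L (U j) (V j) (W j) (hW j h) (l (U j) = 1) (l (V j) = 1)
    (tL _ (pU j)) (tL _ (pV j)) (n j) (n2 j h)
  let K : J → ℤ → ℤ → ℤ → Prop := fun j => Kills (l (U j) = 1) (l (V j) = 1) (s j ∧ l (W j) = 1)
    (s j ∧ -l (W j) = 1) (s j ∧ l (U j) + l (V j) = 1) (s j ∧ l (W j) + (l (U j) + l (V j)) = 1)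
  have st0 : ∀ j, d j = 0 → U j ∈ L ∧ V j ∈ L ∧ W j ∈ L := by
    intro j h0
    have h1 := hd j
    by_cases h : s j
    · exact (hs3 j h).1 (by simp only [D, h, if_true] at h1; omega)
    · exact (hs2 j h).1 (by simp only [D, h, if_false] at h1; omega)
  have st1 : ∀ j, d j = 1 → ∃ α β γ : ℤ, ∃ g : E, (¬ s j → γ = 0) ∧ Adm α β ∧ K j α β γ ∧
      (α ≠ 0 ∨ β ≠ 0 ∨ γ ≠ 0) ∧ U j - α • g ∈ L ∧ V j - β • g ∈ L ∧ W j - γ • g ∈ L := by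
    intro j h0
    have h1 := hd j
    by_cases h : s j
    · obtain ⟨α, β, γ, g, hh⟩ := (hs3 j h).2.1 (by simp only [D, h, if_true] at h1; omega)
      refine ⟨α, β, γ, g, fun h' => absurd h h', ?_⟩
      simpa only [K, h, true_and] using hh
    · obtain ⟨α, β, γ, g, h0, hh⟩ := (hs2 j h).2 (by simp only [D, h, if_false] at h1; omega)
      refine ⟨α, β, γ, g, fun h' => h0, ?_⟩
      simpa only [K, h, false_and] using hh
  have st2 : ∀ j, d j = 2 → (s j ∧ K j 0 0 1) ∨ (U j ∈ L → V j ∈ L → W j ∈ L) := by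
    intro j h0
    have h1 := hd j
    by_cases h : s j
    · rcases (hs3 j h).2.2 (by simp only [D, h, if_true] at h1; omega) with h' | h'
      · left; refine ⟨h, ?_⟩; simpa only [K, h, true_and] using h'
      · exact .inr h'
    · right; intro _ _; rw [hW j h]; exact L.zero_mem
  -- functionals
  have hfun : ∀ A B C : J → ℤ, ∑ j, A j = 0 → ∑ j, B j = 0 → (∀ j, ¬ s j → C j = 0) →
      (∀ j, K j (A j) (B j) (C j)) → ∀ j, A j = 0 ∧ B j = 0 ∧ C j = 0 := by
    intro A B C hA hB hC hK
    obtain ⟨f, hf⟩ := hext (fun j => A j) (fun j => B j) (fun j => C j) (by exact_mod_cast hA)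
      (by exact_mod_cast hB) (fun j hj => by exact_mod_cast hC j hj)
    have hf0 : f = 0 := by
      have : Submodule.span ℝ T ≤ LinearMap.ker f := by
        rw [Submodule.span_le]
        intro x hx
        obtain ⟨⟨j, hx⟩, h⟩ := (hT x).1 hx
        obtain ⟨k1, k2, k3, k4, k5, k6⟩ := hK j
        obtain ⟨f1, f2, f3⟩ := hf j
        simp only [SetLike.mem_coe, LinearMap.mem_ker]
        rcases hx with rfl | rfl | ⟨h', rfl | rfl | rfl | rfl⟩
        · rw [f1]; exact_mod_cast k1 h
        · rw [f2]; exact_mod_cast k2 h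
        · rw [f3]; exact_mod_cast k3 ⟨h', h⟩
        · rw [map_neg, f3]; simpa using k4 ⟨h', by simpa using h⟩
        · rw [map_add, f1, f2]; exact_mod_cast k5 ⟨h', by simpa using h⟩
        · rw [map_add, map_add, f1, f2, f3]; exact_mod_cast k6 ⟨h', by simpa using h⟩
      rw [hspan, top_le_iff, LinearMap.ker_eq_top] at this
      exact this
    intro j
    obtain ⟨f1, f2, f3⟩ := hf j
    rw [hf0] at f1 f2 f3
    simp only [LinearMap.zero_apply] at f1 f2 f3
    exact ⟨by exact_mod_cast f1.symm, by exact_mod_cast f2.symm, by exact_mod_cast f3.symm⟩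
  have K0 : ∀ j, K j 0 0 0 := fun j => by simp [K, Kills]
  have Ksmul : ∀ j x α β γ, K j α β γ → K j (x * α) (x * β) (x * γ) := by
    rintro j x α β γ ⟨k1, k2, k3, k4, k5, k6⟩
    refine ⟨fun h => by rw [k1 h, mul_zero], fun h => by rw [k2 h, mul_zero],
      fun h => by rw [k3 h, mul_zero], fun h => by rw [k4 h, mul_zero],
      fun h => by rw [← mul_add, k5 h, mul_zero],
      fun h => by rw [← mul_add, ← mul_add, k6 h, mul_zero]⟩
  rcases sum_two d hdeq with ⟨i, hi, hrest⟩ | ⟨i, j, hij, hi, hj, hrest⟩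
  · have hUi : U i ∈ L := by
      have h1 := Finset.add_sum_erase Finset.univ U (Finset.mem_univ i)
      rw [hU] at h1
      rw [eq_neg_of_add_eq_zero_left h1]
      exact L.neg_mem (L.sum_mem fun k hk => (st0 k (hrest k (Finset.ne_of_mem_erase hk))).1)
    have hVi : V i ∈ L := by
      have h1 := Finset.add_sum_erase Finset.univ V (Finset.mem_univ i)
      rw [hV] at h1
      rw [eq_neg_of_add_eq_zero_left h1]
      exact L.neg_mem (L.sum_mem fun k hk => (st0 k (hrest k (Finset.ne_of_mem_erase hk))).2.1)
    have hWi : W i ∈ L := by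
      rcases st2 i hi with ⟨h, h'⟩ | h
      · exfalso
        have := (hfun 0 0 (Pi.single i 1) (by simp) (by simp) (fun k hk => by
          have : k ≠ i := by rintro rfl; exact hk h
          simp [this]) (fun k => by
            by_cases hk : k = i
            · subst hk; simpa using h'
            · simpa [hk] using K0 k) i).2.2
        simp at this
      · exact h hUi hVi
    intro k
    by_cases hk : k = i
    · subst hk; exact ⟨hUi, hVi, hWi⟩
    · exact st0 k (hrest k hk)
  · obtain ⟨α, β, γ, g, hs, hA, hK, hne, m1, m2, m3⟩ := st1 i hi
    obtain ⟨α', β', γ', g', hs', hA', hK', hne', m1', m2', m3'⟩ := st1 j hj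
    have hji : j ≠ i := hij.symm
    have two : ∀ X : J → E, ∑ j, X j = 0 → (∀ k, k ≠ i → k ≠ j → X k ∈ L) → X i + X j ∈ L := by
      intro X hX hk
      have h1 := Finset.add_sum_erase Finset.univ X (Finset.mem_univ i)
      have h2 := Finset.add_sum_erase (Finset.univ.erase i) X (a := j) (by simp [hji])
      rw [hX, ← h2, ← add_assoc] at h1
      rw [eq_neg_of_add_eq_zero_left h1]
      refine L.neg_mem (L.sum_mem fun k hk' => ?_)
      simp only [Finset.mem_erase] at hk'
      exact hk k hk'.2.1 hk'.1
    have r1 : α • g + α' • g' ∈ L := by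
      have h1 := two U hU fun k h h' => (st0 k (hrest k h h')).1
      have h2 := L.sub_mem h1 (L.add_mem m1 m1')
      rwa [show U i + U j - (U i - α • g + (U j - α' • g')) = α • g + α' • g' by abel] at h2
    have r2 : β • g + β' • g' ∈ L := by
      have h1 := two V hV fun k h h' => (st0 k (hrest k h h')).2.1
      have h2 := L.sub_mem h1 (L.add_mem m2 m2')
      rwa [show V i + V j - (V i - β • g + (V j - β' • g')) = β • g + β' • g' by abel] at h2
    have hgg : g ∈ L ∧ g' ∈ L := by
      rcases adm_det α β α' β' hA hA' with ⟨x, y, z, t, q1, q2, q3, q4⟩ | ⟨x, y, hxy, q1, q2⟩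
      · constructor
        · have h := L.add_mem (L.smul_mem x r1) (L.smul_mem y r2)
          rwa [show x • (α • g + α' • g') + y • (β • g + β' • g') =
            (x * α + y * β) • g + (x * α' + y * β') • g' by module, q1, q2, one_smul, zero_smul,
            add_zero] at h
        · have h := L.add_mem (L.smul_mem z r1) (L.smul_mem t r2)
          rwa [show z • (α • g + α' • g') + t • (β • g + β' • g') =
            (z * α + t * β) • g + (z * α' + t * β') • g' by module, q3, q4, one_smul, zero_smul,
            zero_add] at h
      · exfalso
        have key := hfun (Pi.single i (x * α) + Pi.single j (y * α'))
          (Pi.single i (x * β) + Pi.single j (y * β')) (Pi.single i (x * γ) + Pi.single j (y * γ'))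
          (by simp [Finset.sum_add_distrib, q1]) (by simp [Finset.sum_add_distrib, q2])
          (fun k hk => by
            by_cases h1 : k = i
            · subst h1; simp [hij, hs hk]
            · by_cases h2 : k = j
              · subst h2; simp [hji, hs' hk]
              · simp [h1, h2])
          (fun k => by
            by_cases h1 : k = i
            · subst h1; simpa [hij] using Ksmul k x _ _ _ hK
            · by_cases h2 : k = j
              · subst h2; simpa [hji] using Ksmul k y _ _ _ hK'
              · simpa [h1, h2] using K0 k)
        have ki := key i
        have kj := key j
        simp [hij, hji] at ki kj
        rcases hxy with h | h
        · simp only [h, false_or] at ki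
          obtain ⟨a1, a2, a3⟩ := ki
          rcases hne with q | q | q
          · exact q a1
          · exact q a2
          · exact q a3
        · simp only [h, false_or] at kj
          obtain ⟨a1, a2, a3⟩ := kj
          rcases hne' with q | q | q
          · exact q a1
          · exact q a2
          · exact q a3
    have back : ∀ (x y : E) (a : ℤ), x - a • y ∈ L → y ∈ L → x ∈ L := by
      intro x y a h1 h2
      have := L.add_mem h1 (L.smul_mem a h2)
      rwa [sub_add_cancel] at this
    intro k
    by_cases h1 : k = i
    · subst h1; exact ⟨back _ _ _ m1 hgg.1, back _ _ _ m2 hgg.1, back _ _ _ m3 hgg.1⟩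
    · by_cases h2 : k = j
      · subst h2; exact ⟨back _ _ _ m1' hgg.2, back _ _ _ m2' hgg.2, back _ _ _ m3' hgg.2⟩
      · exact st0 k (hrest k h1 h2)

open Classical in
theorem sum_block {R : Type*} [Semiring R] (r : ℕ) (s : Fin (2 * r + 1) → Prop)
    (hs : ∀ j, s j ↔ j.val < r) (x y : R) :
    ∑ j, (if s j then x else y) = r * x + (r + 1) * y := by
  have h1 : ∑ j, (if s j then x else y) =
      ∑ j : Fin (2 * r + 1), (fun k : ℕ => if k < r then x else y) j.val :=
    Finset.sum_congr rfl fun j _ => by simp [hs]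
  rw [h1, Fin.sum_univ_eq_sum_range (fun k : ℕ => if k < r then x else y),
    show 2 * r + 1 = r + (r + 1) by ring, Finset.sum_range_add]
  have h2 : ∑ k ∈ Finset.range r, (if k < r then x else y) = r * x := by
    rw [Finset.sum_congr rfl fun k hk => if_pos (Finset.mem_range.1 hk)]; simp
  rw [h2]
  simp

abbrev EE (r : ℕ) := EuclideanSpace ℝ (Fin (5 * r))

def Ub (r : ℕ) : Fin (2 * r + 1) → EE r := Fin.snoc (α := fun _ => EE r) (uvec r) (uLast r)
def Vb (r : ℕ) : Fin (2 * r + 1) → EE r := Fin.snoc (α := fun _ => EE r) (vvec r) (vLast r)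
def Wb (r : ℕ) : Fin (2 * r + 1) → EE r := fun j => if h : j.val < r then wvec r ⟨j, h⟩ else 0

/-- embedding of the first `r` blocks -/
def emb (r : ℕ) (i : Fin r) : Fin (2 * r + 1) := Fin.castSucc (Fin.castLE (by omega) i)

theorem Ub_cast (r : ℕ) (i : Fin (2 * r)) : Ub r i.castSucc = uvec r i := by simp [Ub]
theorem Vb_cast (r : ℕ) (i : Fin (2 * r)) : Vb r i.castSucc = vvec r i := by simp [Vb]
theorem Ub_last (r : ℕ) : Ub r (Fin.last _) = uLast r := by simp [Ub]
theorem Vb_last (r : ℕ) : Vb r (Fin.last _) = vLast r := by simp [Vb]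
theorem Wb_emb (r : ℕ) (i : Fin r) : Wb r (emb r i) = wvec r i := by simp [Wb, emb]
theorem UV_emb (r : ℕ) (i : Fin r) : Ub r (emb r i) + Vb r (emb r i) = yvec r i := by
  rw [emb, Ub_cast, Vb_cast, yvec]
theorem emb_lt (r : ℕ) (i : Fin r) : (emb r i).val < r := by simp [emb]
theorem exists_emb (r : ℕ) (j : Fin (2 * r + 1)) (h : j.val < r) : ∃ i, j = emb r i :=
  ⟨⟨j, h⟩, by ext; simp [emb]⟩

theorem mem_Vr (r : ℕ) (x : EE r) :
    x ∈ Vr r ↔ x ∈ Pts (fun j : Fin (2 * r + 1) => j.val < r) (Ub r) (Vb r) (Wb r) := by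
  constructor
  · rintro (((((((⟨i, rfl⟩ | rfl) | ⟨i, rfl⟩) | rfl) | ⟨i, rfl⟩) | ⟨i, rfl⟩) | ⟨i, rfl⟩) | ⟨i, rfl⟩)
    · exact ⟨i.castSucc, .inl (Ub_cast r i).symm⟩
    · exact ⟨Fin.last _, .inl (Ub_last r).symm⟩
    · exact ⟨i.castSucc, .inr (.inl (Vb_cast r i).symm)⟩
    · exact ⟨Fin.last _, .inr (.inl (Vb_last r).symm)⟩
    · exact ⟨emb r i, .inr (.inr ⟨emb_lt r i, .inl (Wb_emb r i).symm⟩)⟩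
    · exact ⟨emb r i, .inr (.inr ⟨emb_lt r i, .inr (.inl (by rw [Wb_emb]))⟩)⟩
    · exact ⟨emb r i, .inr (.inr ⟨emb_lt r i, .inr (.inr (.inl (UV_emb r i).symm))⟩)⟩
    · exact ⟨emb r i, .inr (.inr ⟨emb_lt r i, .inr (.inr (.inr
        (by rw [UV_emb, Wb_emb, zvec])))⟩)⟩
  · rintro ⟨j, h⟩
    unfold Vr
    simp only [Set.mem_union, Set.mem_range, Set.mem_singleton_iff]
    rcases h with rfl | rfl | ⟨h, h'⟩
    · cases j using Fin.lastCases with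
      | last => rw [Ub_last]; simp
      | cast i => rw [Ub_cast]; simp
    · cases j using Fin.lastCases with
      | last => rw [Vb_last]; simp
      | cast i => rw [Vb_cast]; simp
    · obtain ⟨i, rfl⟩ := exists_emb r j h
      rw [UV_emb, Wb_emb] at h'
      rcases h' with rfl | rfl | rfl | rfl
      · simp
      · simp
      · simp
      · rw [← zvec]; simp

theorem sum_Ub (r : ℕ) : ∑ j, Ub r j = 0 := by
  rw [Fin.sum_univ_castSucc, Ub_last]; simp [Ub_cast, uLast]
theorem sum_Vb (r : ℕ) : ∑ j, Vb r j = 0 := by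
  rw [Fin.sum_univ_castSucc, Vb_last]; simp [Vb_cast, vLast]

theorem ext_fun (r : ℕ) (A B C : Fin (2 * r + 1) → ℝ) (hA : ∑ j, A j = 0) (hB : ∑ j, B j = 0)
    (hC : ∀ j, ¬ j.val < r → C j = 0) :
    ∃ f : EE r →ₗ[ℝ] ℝ, ∀ j, f (Ub r j) = A j ∧ f (Vb r j) = B j ∧ f (Wb r j) = C j := by
  let b := (EuclideanSpace.basisFun (Fin (5 * r)) ℝ).toBasis
  let coef : Fin (5 * r) → ℝ := fun k =>
    if h : k.val < 2 * r then A ⟨k, by omega⟩ else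
    if h' : k.val < 4 * r then B ⟨k - 2 * r, by omega⟩ else C ⟨k - 4 * r, by omega⟩
  let f := b.constr ℝ coef
  have hf : ∀ k, f (EuclideanSpace.single k 1) = coef k := by
    intro k
    have := b.constr_basis ℝ coef k
    rwa [show b k = EuclideanSpace.single k (1 : ℝ) by
      simp only [b, OrthonormalBasis.coe_toBasis, EuclideanSpace.basisFun_apply]] at this
  have fu : ∀ i : Fin (2 * r), f (uvec r i) = A i.castSucc := by
    intro i
    rw [uvec, hf]
    simp only [coef, Fin.val_castLE, i.isLt, dif_pos]
    rfl
  have fv : ∀ i : Fin (2 * r), f (vvec r i) = B i.castSucc := by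
    intro i
    rw [vvec, hf]
    have h1 : ¬ (2 * r + i.val < 2 * r) := by omega
    have h2 : 2 * r + i.val < 4 * r := by omega
    simp only [coef, h1, h2, dif_pos, dif_neg, not_false_eq_true]
    congr 1; ext; simp
  have fw : ∀ i : Fin r, f (wvec r i) = C (emb r i) := by
    intro i
    rw [wvec, hf]
    have h1 : ¬ (4 * r + i.val < 2 * r) := by omega
    have h2 : ¬ (4 * r + i.val < 4 * r) := by omega
    simp only [coef, h1, h2, dif_neg, not_false_eq_true]
    congr 1; ext; simp [emb]
  refine ⟨f, fun j => ⟨?_, ?_, ?_⟩⟩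
  · cases j using Fin.lastCases with
    | last =>
      rw [Ub_last, uLast, map_neg, map_sum]
      rw [Fin.sum_univ_castSucc] at hA
      simp only [fu]; linarith
    | cast i => rw [Ub_cast, fu]
  · cases j using Fin.lastCases with
    | last =>
      rw [Vb_last, vLast, map_neg, map_sum]
      rw [Fin.sum_univ_castSucc] at hB
      simp only [fv]; linarith
    | cast i => rw [Vb_cast, fv]
  · by_cases h : j.val < r
    · obtain ⟨i, rfl⟩ := exists_emb r j h
      rw [Wb_emb, fw]
    · rw [hC j h]; simp [Wb, h]

/-- every standard basis vector is a `U`, `V` or `W` -/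
theorem single_cases (r : ℕ) (k : Fin (5 * r)) :
    (∃ i, EuclideanSpace.single k (1 : ℝ) = uvec r i) ∨
    (∃ i, EuclideanSpace.single k (1 : ℝ) = vvec r i) ∨
    (∃ i, EuclideanSpace.single k (1 : ℝ) = wvec r i) := by
  by_cases h : k.val < 2 * r
  · exact .inl ⟨⟨k, h⟩, by rw [uvec]; congr 1⟩
  · by_cases h' : k.val < 4 * r
    · refine .inr (.inl ⟨⟨k - 2 * r, by omega⟩, ?_⟩)
      rw [vvec]; congr 1; ext; simp; omega
    · refine .inr (.inr ⟨⟨k - 4 * r, by omega⟩, ?_⟩)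
      rw [wvec]; congr 1; ext; simp; omega

/-- all points are integral -/
theorem Vr_integral (r : ℕ) : Vr r ⊆
    (Submodule.span ℤ (Set.range fun i : Fin (5 * r) => EuclideanSpace.single i (1 : ℝ)) :
      Submodule ℤ (EE r)) := by
  set M : Submodule ℤ (EE r) :=
    Submodule.span ℤ (Set.range fun i : Fin (5 * r) => EuclideanSpace.single i (1 : ℝ))
  have hs : ∀ k, EuclideanSpace.single k (1 : ℝ) ∈ M := fun k => Submodule.subset_span ⟨k, rfl⟩
  have hu : ∀ i, uvec r i ∈ M := fun i => hs _
  have hv : ∀ i, vvec r i ∈ M := fun i => hs _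
  have hw : ∀ i, wvec r i ∈ M := fun i => hs _
  have hy : ∀ i, yvec r i ∈ M := fun i => M.add_mem (hu _) (hv _)
  rintro x (((((((⟨i, rfl⟩ | rfl) | ⟨i, rfl⟩) | rfl) | ⟨i, rfl⟩) | ⟨i, rfl⟩) | ⟨i, rfl⟩) | ⟨i, rfl⟩)
  · exact hu i
  · exact M.neg_mem (M.sum_mem fun i _ => hu i)
  · exact hv i
  · exact M.neg_mem (M.sum_mem fun i _ => hv i)
  · exact hw i
  · exact M.neg_mem (hw i)
  · exact hy i
  · exact M.add_mem (hw i) (hy i)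

theorem span_eq_top_of (r : ℕ) (M : Submodule ℝ (EE r))
    (h : ∀ k, EuclideanSpace.single k (1 : ℝ) ∈ M) : M = ⊤ := by
  rw [eq_top_iff, ← (EuclideanSpace.basisFun (Fin (5 * r)) ℝ).toBasis.span_eq, Submodule.span_le]
  rintro _ ⟨k, rfl⟩
  rw [OrthonormalBasis.coe_toBasis, EuclideanSpace.basisFun_apply]
  exact h k

/-- For `r ≥ 1`, let `Δ_r = conv(Vr r) ⊂ ℝ^{5r}`.  For every facet `F` of
`Δ_r` (an exposed face of dimension `5r − 1`), the set of the `8r + 2` points lying in `F`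
has exactly `5r` elements, is linearly independent over `ℤ`, and spans the integer lattice
`ℤ^{5r}` over `ℤ`; i.e. it forms a `ℤ`-basis of `ℤ^{5r} ⊂ ℝ^{5r}`. -/
theorem stmt7 (r : ℕ) (hr : 1 ≤ r) (F : Set (EuclideanSpace ℝ (Fin (5 * r))))
    (hface : IsExposed ℝ (convexHull ℝ (Vr r)) F)
    (hdim : Module.finrank ℝ (vectorSpan ℝ F) = 5 * r - 1) :
    (Vr r ∩ F).ncard = 5 * r ∧
    LinearIndependent ℤ (fun p : ↥(Vr r ∩ F) => (p : EuclideanSpace ℝ (Fin (5 * r)))) ∧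
    Submodule.span ℤ (Vr r ∩ F) =
      Submodule.span ℤ (Set.range fun i : Fin (5 * r) => EuclideanSpace.single i (1 : ℝ)) := by
  have hne : F.Nonempty := by
    by_contra h
    rw [Set.not_nonempty_iff_eq_empty] at h
    subst h
    rw [vectorSpan_empty, finrank_bot] at hdim
    omega
  obtain ⟨l0, hl0⟩ := hface hne
  obtain ⟨x0, hx0⟩ := hne
  have hmax : ∀ y ∈ convexHull ℝ (Vr r), l0 y ≤ l0 x0 := by
    rw [hl0] at hx0; exact hx0.2
  have hF : ∀ x, x ∈ F ↔ x ∈ convexHull ℝ (Vr r) ∧ l0 x = l0 x0 := by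
    intro x
    constructor
    · intro hx
      have hx' := hx
      rw [hl0] at hx'
      have hx0' := hx0
      rw [hl0] at hx0'
      exact ⟨hx'.1, le_antisymm (hmax x hx'.1) (hx'.2 x0 hx0'.1)⟩
    · rintro ⟨h1, h2⟩
      rw [hl0]
      exact ⟨h1, fun y hy => h2 ▸ hmax y hy⟩
  have hsub : Vr r ⊆ convexHull ℝ (Vr r) := subset_convexHull ℝ _
  have hVmax : ∀ y ∈ Vr r, l0 y ≤ l0 x0 := fun y hy => hmax y (hsub hy)
  have mU : ∀ j, Ub r j ∈ Vr r := fun j => (mem_Vr r _).2 ⟨j, .inl rfl⟩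
  have mV : ∀ j, Vb r j ∈ Vr r := fun j => (mem_Vr r _).2 ⟨j, .inr (.inl rfl)⟩
  have mW : ∀ i, wvec r i ∈ Vr r := fun i => by simp [Vr]
  have mn : ∀ i, -wvec r i ∈ Vr r := fun i => by simp [Vr]
  have mS : ∀ k, EuclideanSpace.single k (1 : ℝ) ∈ Vr r := by
    intro k
    rcases single_cases r k with ⟨i, h⟩ | ⟨i, h⟩ | ⟨i, h⟩
    · rw [h, ← Ub_cast]; exact mU _
    · rw [h, ← Vb_cast]; exact mV _
    · rw [h]; exact mW _
  have h0 : (0 : EE r) ∈ convexHull ℝ (Vr r) := by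
    have := (convex_convexHull ℝ (Vr r)) (hsub (mW ⟨0, hr⟩)) (hsub (mn ⟨0, hr⟩))
      (a := 1 / 2) (b := 1 / 2) (by norm_num) (by norm_num) (by norm_num)
    simpa using this
  have hc0 : 0 ≤ l0 x0 := by simpa using hmax 0 h0
  have hcne : l0 x0 ≠ 0 := by
    intro hc
    rw [hc] at hVmax
    have zero_of : ∀ X : Fin (2 * r + 1) → EE r, (∀ j, X j ∈ Vr r) → ∑ j, X j = 0 →
        ∀ j, l0 (X j) = 0 := by
      intro X hX hs j
      have h1 : ∑ j, l0 (X j) = 0 := by rw [← map_sum, hs, map_zero]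
      exact (Finset.sum_eq_zero_iff_of_nonpos fun j _ => hVmax _ (hX j)).1 h1 j (Finset.mem_univ j)
    have hSl : ∀ k, l0 (EuclideanSpace.single k (1 : ℝ)) = 0 := by
      intro k
      rcases single_cases r k with ⟨i, h⟩ | ⟨i, h⟩ | ⟨i, h⟩
      · rw [h, ← Ub_cast]; exact zero_of _ mU (sum_Ub r) _
      · rw [h, ← Vb_cast]; exact zero_of _ mV (sum_Vb r) _
      · rw [h]
        have h1 := hVmax _ (mW i)
        have h2 := hVmax _ (mn i)
        rw [map_neg] at h2
        linarith
    have hFS : ∀ k, EuclideanSpace.single k (1 : ℝ) ∈ F := fun k =>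
      (hF _).2 ⟨hsub (mS k), by rw [hSl, hc]⟩
    have hF0 : (0 : EE r) ∈ F := (hF _).2 ⟨h0, by rw [hc, map_zero]⟩
    have htop := span_eq_top_of r (vectorSpan ℝ F) fun k => by
      simpa using vsub_mem_vectorSpan ℝ (hFS k) hF0
    rw [htop, finrank_top, finrank_euclideanSpace_fin] at hdim
    omega
  have hc : 0 < l0 x0 := lt_of_le_of_ne hc0 hcne.symm
  -- spanning
  have hFspan : F ⊆ Submodule.span ℝ (Vr r ∩ F) := by
    have hK : convexHull ℝ (Vr r) ⊆
        {x | l0 x ≤ l0 x0 ∧ (l0 x = l0 x0 → x ∈ Submodule.span ℝ (Vr r ∩ F))} := by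
      apply convexHull_min
      · intro x hx
        exact ⟨hVmax x hx, fun h => Submodule.subset_span ⟨hx, (hF x).2 ⟨hsub hx, h⟩⟩⟩
      · rw [convex_iff_forall_pos]
        rintro x ⟨hx, hx'⟩ y ⟨hy, hy'⟩ a b ha hb hab
        have e : l0 (a • x + b • y) = a * l0 x + b * l0 y := by simp
        have e' : l0 x0 = a * l0 x0 + b * l0 x0 := by rw [← add_mul, hab, one_mul]
        have i1 := mul_le_mul_of_nonneg_left hx ha.le
        have i2 := mul_le_mul_of_nonneg_left hy hb.le
        refine ⟨by rw [e]; linarith, fun h => ?_⟩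
        rw [e] at h
        have j1 : l0 x = l0 x0 := mul_left_cancel₀ ha.ne' (by linarith)
        have j2 : l0 y = l0 x0 := mul_left_cancel₀ hb.ne' (by linarith)
        exact Submodule.add_mem _ (Submodule.smul_mem _ _ (hx' j1))
          (Submodule.smul_mem _ _ (hy' j2))
    intro x hx
    exact (hK ((hF x).1 hx).1).2 ((hF x).1 hx).2
  have hspan : Submodule.span ℝ (Vr r ∩ F) = ⊤ := by
    have h1 : vectorSpan ℝ F ≤ Submodule.span ℝ (Vr r ∩ F) := by
      rw [vectorSpan_def, Submodule.span_le]
      rintro _ ⟨x, hx, y, hy, rfl⟩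
      exact Submodule.sub_mem _ (hFspan hx) (hFspan hy)
    have h2 : vectorSpan ℝ F ≤ LinearMap.ker l0.toLinearMap := by
      rw [vectorSpan_def, Submodule.span_le]
      rintro _ ⟨x, hx, y, hy, rfl⟩
      have := ((hF x).1 hx).2
      have := ((hF y).1 hy).2
      simp_all
    have h3 : vectorSpan ℝ F < Submodule.span ℝ (Vr r ∩ F) := by
      refine lt_of_le_of_ne h1 fun h => ?_
      have : x0 ∈ vectorSpan ℝ F := h ▸ hFspan hx0
      have := h2 this
      exact hcne (by simpa using this)
    have h4 := Submodule.finrank_lt_finrank_of_lt h3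
    apply Submodule.eq_top_of_finrank_eq
    have h5 := Submodule.finrank_le (Submodule.span ℝ (Vr r ∩ F))
    rw [finrank_euclideanSpace_fin] at h5 ⊢
    omega
  let l : EE r →ₗ[ℝ] ℝ := (l0 x0)⁻¹ • l0.toLinearMap
  have hl : ∀ x, l x = (l0 x0)⁻¹ * l0 x := fun x => rfl
  have hT : ∀ x, x ∈ Vr r ∩ F ↔
      x ∈ Pts (fun j : Fin (2 * r + 1) => j.val < r) (Ub r) (Vb r) (Wb r) ∧ l x = 1 := by
    intro x
    rw [← mem_Vr, hl, Set.mem_inter_iff, hF, inv_mul_eq_one₀ hcne]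
    exact ⟨fun h => ⟨h.1, h.2.2.symm⟩, fun h => ⟨h.1, hsub h.1, h.2.symm⟩⟩
  have hcore := core (fun j : Fin (2 * r + 1) => j.val < r) (Ub r) (Vb r) (Wb r) (sum_Ub r)
    (sum_Vb r) (fun j h => by simp only [Wb, h, dif_neg, not_false_eq_true]) (ext_fun r)
    (by
      refine lt_of_lt_of_eq ?_ (sum_block r _ (fun j => Iff.rfl) (-1 : ℝ) 1).symm
      linarith) l (Vr r ∩ F) hT
    (fun x hx => by
      rw [hl, inv_mul_le_one₀ hc]
      exact hVmax x ((mem_Vr r x).2 hx)) hspan (5 * r)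
    (by refine (sum_block r _ (fun j => Iff.rfl) 3 2).trans ?_; simp; ring) finrank_euclideanSpace_fin
  obtain ⟨hcard, hmem⟩ := hcore
  have hfinite : (Vr r ∩ F).Finite := Set.finite_of_ncard_pos (by omega)
  refine ⟨hcard, ?_, ?_⟩
  · have := hfinite.fintype
    have hR : LinearIndependent ℝ (fun p : ↥(Vr r ∩ F) => (p : EE r)) := by
      apply linearIndependent_of_top_le_span_of_card_eq_finrank
      · rw [Subtype.range_coe, hspan]
      · rw [finrank_euclideanSpace_fin, ← Nat.card_eq_fintype_card, Nat.card_coe_set_eq]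
        exact hcard
    exact hR.restrict_scalars (by
      intro a b h
      simpa using h)
  · apply le_antisymm
    · rw [Submodule.span_le]
      exact fun x hx => Vr_integral r hx.1
    · rw [Submodule.span_le]
      rintro _ ⟨k, rfl⟩
      show EuclideanSpace.single k (1 : ℝ) ∈ Submodule.span ℤ (Vr r ∩ F)
      rcases single_cases r k with ⟨i, h⟩ | ⟨i, h⟩ | ⟨i, h⟩
      · rw [h, ← Ub_cast]; exact (hmem _).1
      · rw [h, ← Vb_cast]; exact (hmem _).2.1
      · rw [h, ← Wb_emb]; exact (hmem _).2.2
end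
end
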